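/- arXiv:2411.01721 — 11 statements merged into one kernel-verified Lean document; each statement's English description precedes it below -/
import Mathlib

section
/- Let G be an n-node graph with adjacency matrix A (with diagonal entries equal to 1), let γ ≥ 0, and let S ⊆ [n] be an independent set of size k ≥ 1. In the 2n×2n independent-set game (R, C) with parameters γ, k, the strategy pair ((u(S), 0_n), (u(S), 0_n)) ∈ Δ^{2n} × Δ^{2n} — both players play the uniform distribution over S, assigning no mass to the last n actions — is a Nash equilibrium in which each player's utility equals (1 + γ/k)/2; in particular its welfare equals 1 + γ/k. -/
open Finset Matrix

noncomputable section

/-- The probability simplex Δⁿ on `Fin n`. -/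
def simplex (n : ℕ) : Set (Fin n → ℝ) :=
  {x | (∀ i, 0 ≤ x i) ∧ ∑ i, x i = 1}

/-- The linear action of a deviation `φ : [n] → [n]` on vectors:
`(φ(x))_{i'} = ∑_{i : φ(i) = i'} x_i`. -/
def devApply {n : ℕ} (φ : Fin n → Fin n) (x : Fin n → ℝ) : Fin n → ℝ :=
  fun i' => ∑ i, if φ i = i' then x i else 0

/-- The deviation set Φ: either `φ(i) = i'` for all `i ≤ i₀` and `φ(i) = i` for `i > i₀`,
or `φ` is an internal deviation (identity on all but at most one point). -/
def InPhi {n : ℕ} (φ : Fin n → Fin n) : Prop :=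
  (∃ i' i₀ : Fin n, ∀ i, (i ≤ i₀ → φ i = i') ∧ (i₀ < i → φ i = i)) ∨
  (∃ i₀ : Fin n, ∀ i, i ≠ i₀ → φ i = i)

/-- `μ = (1/T) ∑_t x^{(t)} ⊗ y^{(t)}` is a uniform `T`-sparse `ε`-CE of `(R, C)`. -/
def IsSparseCE {n : ℕ} (R C : Matrix (Fin n) (Fin n) ℝ) (T : ℕ)
    (x y : Fin T → Fin n → ℝ) (ε : ℝ) : Prop :=
  ∀ φx φy : Fin n → Fin n, InPhi φx → InPhi φy →
    (1 / (T : ℝ)) * ∑ t, x t ⬝ᵥ R.mulVec (y t) ≥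
      (1 / (T : ℝ)) * ∑ t, devApply φx (x t) ⬝ᵥ R.mulVec (y t) - ε ∧
    (1 / (T : ℝ)) * ∑ t, x t ⬝ᵥ C.mulVec (y t) ≥
      (1 / (T : ℝ)) * ∑ t, x t ⬝ᵥ C.mulVec (devApply φy (y t)) - ε

/-- `μ = (1/T) ∑_t x^{(t)} ⊗ y^{(t)}` is a uniform `T`-sparse `ε`-CCE of `(R, C)`. -/
def IsSparseCCE {n : ℕ} (R C : Matrix (Fin n) (Fin n) ℝ) (T : ℕ)
    (x y : Fin T → Fin n → ℝ) (ε : ℝ) : Prop :=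
  (∀ x' ∈ simplex n,
    (1 / (T : ℝ)) * ∑ t, x t ⬝ᵥ R.mulVec (y t) ≥
      (1 / (T : ℝ)) * ∑ t, x' ⬝ᵥ R.mulVec (y t) - ε) ∧
  (∀ y' ∈ simplex n,
    (1 / (T : ℝ)) * ∑ t, x t ⬝ᵥ C.mulVec (y t) ≥
      (1 / (T : ℝ)) * ∑ t, x t ⬝ᵥ C.mulVec y' - ε)

/-- `(x, y)` is an `ε`-Nash equilibrium of `(R, C)`. -/
def IsNash {n : ℕ} (R C : Matrix (Fin n) (Fin n) ℝ) (x y : Fin n → ℝ) (ε : ℝ) : Prop :=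
  (∀ x' ∈ simplex n, x ⬝ᵥ R.mulVec y ≥ x' ⬝ᵥ R.mulVec y - ε) ∧
  (∀ y' ∈ simplex n, x ⬝ᵥ C.mulVec y ≥ x ⬝ᵥ C.mulVec y' - ε)

/-- The uniform distribution `u(S)` over a subset `S ⊆ [n]`. -/
def unif {n : ℕ} (S : Finset (Fin n)) : Fin n → ℝ :=
  fun i => if i ∈ S then (S.card : ℝ)⁻¹ else 0

/-- Embedding of the first `n` actions into `[2n]`. -/
def finL {n : ℕ} (i : Fin n) : Fin (2 * n) := ⟨(i : ℕ), by have := i.isLt; omega⟩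

/-- Embedding of the last `n` actions into `[2n]`. -/
def finR {n : ℕ} (i : Fin n) : Fin (2 * n) := ⟨n + (i : ℕ), by have := i.isLt; omega⟩

/-- `S` is an independent set of the graph with adjacency matrix `A`. -/
def IsIndepSet {n : ℕ} (A : Matrix (Fin n) (Fin n) ℝ) (S : Finset (Fin n)) : Prop :=
  ∀ i ∈ S, ∀ j ∈ S, i ≠ j → A i j = 0

/-- Row player's payoff matrix of the `2n × 2n` independent-set game:
`R = (1/2)·[[1 − A + (γ+1)I, −k·I], [k·I, 0]]`. -/
def ISR (n : ℕ) (A : Matrix (Fin n) (Fin n) ℝ) (γ k : ℝ) :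
    Matrix (Fin (2 * n)) (Fin (2 * n)) ℝ := fun i j =>
  if hi : (i : ℕ) < n then
    if hj : (j : ℕ) < n then
      (1 / 2) * ((1 - A ⟨(i : ℕ), hi⟩ ⟨(j : ℕ), hj⟩) +
        (γ + 1) * (if (i : ℕ) = (j : ℕ) then 1 else 0))
    else (1 / 2) * (-k) * (if (i : ℕ) + n = (j : ℕ) then 1 else 0)
  else
    if _hj : (j : ℕ) < n then
      (1 / 2) * k * (if (i : ℕ) = (j : ℕ) + n then 1 else 0)
    else 0

/-- Column player's payoff matrix of the `2n × 2n` independent-set game: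
`C = (1/2)·[[1 − A + (γ+1)I, k·I], [−k·I, 0]]`. -/
def ISC (n : ℕ) (A : Matrix (Fin n) (Fin n) ℝ) (γ k : ℝ) :
    Matrix (Fin (2 * n)) (Fin (2 * n)) ℝ := fun i j =>
  if hi : (i : ℕ) < n then
    if hj : (j : ℕ) < n then
      (1 / 2) * ((1 - A ⟨(i : ℕ), hi⟩ ⟨(j : ℕ), hj⟩) +
        (γ + 1) * (if (i : ℕ) = (j : ℕ) then 1 else 0))
    else (1 / 2) * k * (if (i : ℕ) + n = (j : ℕ) then 1 else 0)
  else
    if _hj : (j : ℕ) < n then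
      (1 / 2) * (-k) * (if (i : ℕ) = (j : ℕ) + n then 1 else 0)
    else 0

theorem aux_sum {n : ℕ} (f : Fin (2 * n) → ℝ) (S : Finset (Fin n)) (c : ℝ)
    (xS : Fin (2 * n) → ℝ)
    (hxS : ∀ i : Fin (2 * n),
      xS i = if h : (i : ℕ) < n then
        (if (⟨(i : ℕ), h⟩ : Fin n) ∈ S then c else 0) else 0) :
    ∑ i, f i * xS i = c * ∑ j ∈ S, f (finL j) := by
  have hinj : Function.Injective (finL : Fin n → Fin (2 * n)) := by
    intro a b h
    simp only [finL, Fin.mk.injEq] at h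
    exact Fin.ext h
  rw [Finset.mul_sum, ← Finset.sum_image (s := S) (g := finL) (f := fun i => c * f i)
    (fun a _ b _ h => hinj h)]
  symm
  apply Finset.sum_subset_zero_on_sdiff (Finset.subset_univ _)
  · intro i hi
    simp only [Finset.mem_sdiff, Finset.mem_univ, true_and, Finset.mem_image, not_exists,
      not_and] at hi
    rw [hxS]
    split_ifs with h1 h2
    · exact absurd rfl (hi _ h2)
    · simp
    · simp
  · intro i hi
    simp only [Finset.mem_image] at hi
    obtain ⟨j, hj, rfl⟩ := hi
    rw [hxS]
    have : ((finL j : Fin (2 * n)) : ℕ) < n := j.isLt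
    rw [dif_pos this, if_pos (show (⟨((finL j : Fin (2 * n)) : ℕ), this⟩ : Fin n) ∈ S from hj)]
    ring

theorem aux_transpose {n : ℕ} (A : Matrix (Fin n) (Fin n) ℝ)
    (hAsym : ∀ i j, A i j = A j i) (γ k : ℝ) : ISC n A γ k = (ISR n A γ k)ᵀ := by
  ext i j
  simp only [ISC, ISR, Matrix.transpose_apply]
  by_cases hi : (i : ℕ) < n <;> by_cases hj : (j : ℕ) < n
  · simp only [hi, hj, dif_pos]
    rw [hAsym]
    simp only [@eq_comm _ (i : ℕ) (j : ℕ)]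
  · simp [hi, hj, eq_comm]
  · simp [hi, hj, eq_comm]
  · simp [hi, hj]

theorem aux_row {n : ℕ} (A : Matrix (Fin n) (Fin n) ℝ)
    (hA01 : ∀ i j, A i j = 0 ∨ A i j = 1)
    (hAdiag : ∀ i, A i i = 1)
    (γ : ℝ) (hγ : 0 ≤ γ) (k : ℕ) (hk : 1 ≤ k)
    (S : Finset (Fin n)) (hS : IsIndepSet A S) (hScard : S.card = k)
    (xS : Fin (2 * n) → ℝ)
    (hxS : ∀ i : Fin (2 * n),
      xS i = if h : (i : ℕ) < n then
        (if (⟨(i : ℕ), h⟩ : Fin n) ∈ S then (k : ℝ)⁻¹ else 0) else 0) :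
    (∀ i ∈ S, (ISR n A γ (k : ℝ)).mulVec xS (finL i) = (1 + γ / (k : ℝ)) / 2) ∧
    ∀ i, (ISR n A γ (k : ℝ)).mulVec xS i ≤ (1 + γ / (k : ℝ)) / 2 := by
  have hk0 : (0 : ℝ) < k := by exact_mod_cast hk
  have hgk : 0 ≤ γ / (k : ℝ) := by positivity
  have hm : ∀ i, (ISR n A γ (k : ℝ)).mulVec xS i
      = (k : ℝ)⁻¹ * ∑ j ∈ S, ISR n A γ k i (finL j) := fun i =>
    aux_sum (fun j => ISR n A γ k i j) S _ xS hxS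
  have hin : ∀ i ∈ S, (ISR n A γ (k : ℝ)).mulVec xS (finL i) = (1 + γ / (k : ℝ)) / 2 := by
    intro i hi
    rw [hm]
    have : ∀ j ∈ S, ISR n A γ k (finL i) (finL j) = 1 / 2 + (if i = j then γ / 2 else 0) := by
      intro j hj
      simp only [ISR, finL, i.isLt, j.isLt, dif_pos, Fin.eta]
      by_cases h : i = j
      · subst h
        simp [hAdiag]; ring
      · have h' : (i : ℕ) ≠ j := fun e => h (Fin.ext e)
        simp [h, h', hS i hi j hj h]
    rw [Finset.sum_congr rfl this, Finset.sum_add_distrib, Finset.sum_ite_eq, if_pos hi,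
      Finset.sum_const, hScard, nsmul_eq_mul]
    field_simp
  refine ⟨hin, fun i => ?_⟩
  by_cases hi : (i : ℕ) < n
  · by_cases hiS : (⟨i, hi⟩ : Fin n) ∈ S
    · exact (hin _ hiS).le
    · rw [hm]
      have : ∑ j ∈ S, ISR n A γ k i (finL j) ≤ ∑ j ∈ S, (1 / 2 : ℝ) := by
        apply Finset.sum_le_sum
        intro j hj
        have hne : (i : ℕ) ≠ j := by
          intro e
          apply hiS
          have : (⟨i, hi⟩ : Fin n) = j := Fin.ext e
          rw [this]; exact hj
        simp only [ISR, finL, hi, j.isLt, dif_pos, Fin.eta, hne, if_false]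
        rcases hA01 ⟨i, hi⟩ j with h | h <;> rw [h] <;> norm_num
      rw [Finset.sum_const, hScard, nsmul_eq_mul] at this
      calc _ ≤ (k : ℝ)⁻¹ * (k * (1 / 2)) := by gcongr
        _ = 1 / 2 := by field_simp
        _ ≤ _ := by linarith
  · rw [hm]
    have : ∑ j ∈ S, ISR n A γ k i (finL j) ≤ (k : ℝ) / 2 := by
      have hlt : (i : ℕ) - n < n := by have := i.isLt; omega
      have : ∀ j ∈ S, ISR n A γ k i (finL j)
          = if (⟨(i : ℕ) - n, hlt⟩ : Fin n) = j then (k : ℝ) / 2 else 0 := by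
        intro j hj
        have hiff : ((i : ℕ) = (j : ℕ) + n) ↔ (⟨(i : ℕ) - n, hlt⟩ : Fin n) = j := by
          rw [Fin.ext_iff]; simp only []; omega
        simp only [ISR, finL, hi, j.isLt, dif_pos, dif_neg, not_false_eq_true, hiff]
        split_ifs <;> ring
      rw [Finset.sum_congr rfl this, Finset.sum_ite_eq]
      split_ifs
      · exact le_rfl
      · positivity
    calc _ ≤ (k : ℝ)⁻¹ * (k / 2) := by gcongr
      _ = 1 / 2 := by field_simp
      _ ≤ _ := by linarith

/-- in the independent-set game, if `S` is an independent set of size `k ≥ 1`,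
then both players playing the uniform distribution over `S` (with no mass on the last `n`
actions) is a Nash equilibrium in which each player's utility is `(1 + γ/k)/2`;
in particular its welfare is `1 + γ/k`. -/
theorem indepSet_gives_nash {n : ℕ} (A : Matrix (Fin n) (Fin n) ℝ)
    (hA01 : ∀ i j, A i j = 0 ∨ A i j = 1)
    (hAsym : ∀ i j, A i j = A j i)
    (hAdiag : ∀ i, A i i = 1)
    (γ : ℝ) (hγ : 0 ≤ γ) (k : ℕ) (hk : 1 ≤ k)
    (S : Finset (Fin n)) (hS : IsIndepSet A S) (hScard : S.card = k)
    (xS : Fin (2 * n) → ℝ)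
    (hxS : ∀ i : Fin (2 * n),
      xS i = if h : (i : ℕ) < n then
        (if (⟨(i : ℕ), h⟩ : Fin n) ∈ S then (k : ℝ)⁻¹ else 0) else 0) :
    xS ∈ simplex (2 * n) ∧
    IsNash (ISR n A γ (k : ℝ)) (ISC n A γ (k : ℝ)) xS xS 0 ∧
    xS ⬝ᵥ (ISR n A γ (k : ℝ)).mulVec xS = (1 + γ / (k : ℝ)) / 2 ∧
    xS ⬝ᵥ (ISC n A γ (k : ℝ)).mulVec xS = (1 + γ / (k : ℝ)) / 2 ∧
    xS ⬝ᵥ ((ISR n A γ (k : ℝ)) + (ISC n A γ (k : ℝ))).mulVec xS = 1 + γ / (k : ℝ) := by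
  have hk0 : (0 : ℝ) < k := by exact_mod_cast hk
  obtain ⟨hin, hle⟩ := aux_row A hA01 hAdiag γ hγ k hk S hS hScard xS hxS
  have hsw : ∀ a b, a ⬝ᵥ (ISC n A γ (k : ℝ)).mulVec b = b ⬝ᵥ (ISR n A γ (k : ℝ)).mulVec a := by
    intro a b
    rw [aux_transpose A hAsym, Matrix.mulVec_transpose, dotProduct_comm,
      Matrix.dotProduct_mulVec, dotProduct_comm, dotProduct_comm]
  have hsum : ∑ i, xS i = 1 := by
    have := aux_sum (fun _ => 1) S _ xS hxS
    simp only [one_mul] at this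
    rw [this, Finset.sum_const, hScard, nsmul_eq_mul]
    field_simp
  have hval : xS ⬝ᵥ (ISR n A γ (k : ℝ)).mulVec xS = (1 + γ / (k : ℝ)) / 2 := by
    rw [dotProduct_comm]
    have := aux_sum ((ISR n A γ (k : ℝ)).mulVec xS) S _ xS hxS
    rw [dotProduct, this, Finset.sum_congr rfl hin, Finset.sum_const, hScard, nsmul_eq_mul]
    field_simp
  have hdev : ∀ x' ∈ simplex (2 * n),
      x' ⬝ᵥ (ISR n A γ (k : ℝ)).mulVec xS ≤ (1 + γ / (k : ℝ)) / 2 := by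
    intro x' hx'
    calc x' ⬝ᵥ (ISR n A γ (k : ℝ)).mulVec xS ≤ ∑ i, x' i * ((1 + γ / (k : ℝ)) / 2) :=
          Finset.sum_le_sum fun i _ => mul_le_mul_of_nonneg_left (hle i) (hx'.1 i)
      _ = _ := by rw [← Finset.sum_mul, hx'.2, one_mul]
  refine ⟨⟨fun i => ?_, hsum⟩, ⟨fun x' hx' => ?_, fun y' hy' => ?_⟩, hval, ?_, ?_⟩
  · rw [hxS]
    split_ifs <;> positivity
  · have := hdev x' hx'
    rw [hval]; linarith
  · have := hdev y' hy'
    rw [hsw, hsw, hval]; linarith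
  · rw [hsw, hval]
  · rw [Matrix.add_mulVec, dotProduct_add, hsw, hval]; ring
end
end

section
/- Let (R, C) be the 2n×2n independent-set game with parameters γ ≥ 0 and k ≥ 1 + γ, and let μ = (1/T) ∑_{t=1}^T x^{(t)} ⊗ y^{(t)} be a uniform T-sparse ε-CE of (R, C) with welfare at least 1. Assume ∑_{i=1}^n x_i^{(t)} > 0 and ∑_{j=1}^n y_j^{(t)} > 0 for all t ∈ [T]. Define x̂^{(t)} ∈ Δ^{2n} by x̂_i^{(t)} = x_i^{(t)} / ∑_{i'=1}^n x_{i'}^{(t)} for i ≤ n and x̂_i^{(t)} = 0 for i > n, and define ŷ^{(t)} analogously from y^{(t)}. Then μ̂ = (1/T) ∑_{t=1}^T x̂^{(t)} ⊗ ŷ^{(t)} is a uniform T-sparse (ε + 4γk)-CE of (R, C). -/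
open Finset Matrix

noncomputable section

theorem aux_devdot {n : ℕ} (φ : Fin n → Fin n) (x v : Fin n → ℝ) :
    devApply φ x ⬝ᵥ v = ∑ i, x i * v (φ i) := by
  simp only [devApply, dotProduct, Finset.sum_mul, ite_mul, zero_mul]
  rw [Finset.sum_comm]
  simp

theorem aux_form {n : ℕ} (M : Matrix (Fin n) (Fin n) ℝ) (x y : Fin n → ℝ) :
    x ⬝ᵥ M.mulVec y = ∑ i, ∑ j, x i * y j * M i j := by
  simp only [dotProduct, Matrix.mulVec, Finset.mul_sum]
  exact Finset.sum_congr rfl fun i _ => Finset.sum_congr rfl fun j _ => by ring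

theorem aux_row_s2 {n : ℕ} (M : Matrix (Fin n) (Fin n) ℝ) (φ : Fin n → Fin n) (x y : Fin n → ℝ) :
    devApply φ x ⬝ᵥ M.mulVec y - x ⬝ᵥ M.mulVec y
      = ∑ i, ∑ j, x i * y j * (M (φ i) j - M i j) := by
  rw [aux_devdot, aux_form]
  simp only [dotProduct, Matrix.mulVec, Finset.mul_sum, mul_sub, Finset.sum_sub_distrib]
  congr 1
  exact Finset.sum_congr rfl fun i _ => Finset.sum_congr rfl fun j _ => by ring

theorem aux_col {n : ℕ} (M : Matrix (Fin n) (Fin n) ℝ) (φ : Fin n → Fin n) (x y : Fin n → ℝ) :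
    x ⬝ᵥ M.mulVec (devApply φ y) - x ⬝ᵥ M.mulVec y
      = ∑ i, ∑ j, x i * y j * (M i (φ j) - M i j) := by
  rw [aux_form M x y]
  simp only [mul_sub, Finset.sum_sub_distrib]
  congr 1
  simp only [dotProduct, Matrix.mulVec]
  refine Finset.sum_congr rfl fun i _ => ?_
  have := aux_devdot φ y (M i)
  rw [dotProduct_comm] at this
  simp only [dotProduct] at this
  rw [this, Finset.mul_sum]
  exact Finset.sum_congr rfl fun j _ => by ring

theorem aux_mass {n : ℕ} (x y : Fin n → ℝ) (hx : x ∈ simplex n) (hy : y ∈ simplex n) (c : ℝ) :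
    ∑ i, ∑ j, x i * y j * c = c := by
  have h : ∑ i, ∑ j, x i * y j * c = (∑ i, x i) * (∑ j, y j) * c := by
    rw [Finset.sum_mul_sum, Finset.sum_mul]
    simp only [Finset.sum_mul]
  rw [h, hx.2, hy.2]; ring

theorem aux_key {n : ℕ} (M : Fin n → Fin n → ℝ) (k : ℝ) (hM : ∀ i j, |M i j| ≤ k)
    (x y xh yh : Fin n → ℝ) (hx : x ∈ simplex n) (hy : y ∈ simplex n)
    (hxh : xh ∈ simplex n) (hyh : yh ∈ simplex n) (p q : ℝ)
    (hp : 0 ≤ p) (hq : 0 ≤ q) (hpq : p * q ≤ 1)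
    (hpx : ∀ i, p * xh i ≤ x i) (hqy : ∀ j, q * yh j ≤ y j) :
    ∑ i, ∑ j, xh i * yh j * M i j ≤ ∑ i, ∑ j, x i * y j * M i j + 2 * k * (1 - p * q) := by
  have h1 : 0 ≤ ∑ i, ∑ j, (x i * y j - (p * q) * (xh i * yh j)) * (M i j + k) := by
    refine Finset.sum_nonneg fun i _ => Finset.sum_nonneg fun j _ => mul_nonneg ?_ ?_
    · have := mul_le_mul (hpx i) (hqy j) (mul_nonneg hq (hyh.1 j)) (hx.1 i)
      nlinarith
    · have := neg_le_of_abs_le (hM i j); linarith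
  have h2 : ∑ i, ∑ j, xh i * yh j * M i j ≤ k := by
    rw [← aux_mass xh yh hxh hyh k]
    refine Finset.sum_le_sum fun i _ => Finset.sum_le_sum fun j _ => ?_
    exact mul_le_mul_of_nonneg_left (le_of_abs_le (hM i j)) (mul_nonneg (hxh.1 i) (hyh.1 j))
  have h3 : ∑ i, ∑ j, (x i * y j - (p * q) * (xh i * yh j)) * (M i j + k)
      = ∑ i, ∑ j, x i * y j * M i j + ∑ i, ∑ j, x i * y j * k
        - (p * q) * (∑ i, ∑ j, xh i * yh j * M i j + ∑ i, ∑ j, xh i * yh j * k) := by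
    simp only [Finset.mul_sum, ← Finset.sum_add_distrib, ← Finset.sum_sub_distrib]
    exact Finset.sum_congr rfl fun i _ => Finset.sum_congr rfl fun j _ => by ring
  rw [h3, aux_mass x y hx hy, aux_mass xh yh hxh hyh] at h1
  nlinarith

theorem aux_sumL {n : ℕ} (f : Fin (2 * n) → ℝ) :
    ∑ i : Fin (2 * n), (if (i : ℕ) < n then f i else 0) = ∑ i : Fin n, f (finL i) := by
  rw [← Finset.sum_filter]
  symm
  refine Finset.sum_bij (fun i _ => finL i) ?_ ?_ ?_ ?_
  · intro a _; simp [finL]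
  · intro a _ b _ h; simpa [finL, Fin.ext_iff] using h
  · intro b hb
    exact ⟨⟨b, by simpa using hb⟩, Finset.mem_univ _, by simp [finL]⟩
  · intro a _; rfl

theorem aux_hat {n : ℕ} (x xh : Fin (2 * n) → ℝ) (hx : x ∈ simplex (2 * n))
    (hpos : 0 < ∑ i : Fin n, x (finL i))
    (hxh : ∀ i : Fin (2 * n),
      xh i = if (i : ℕ) < n then x i / (∑ i' : Fin n, x (finL i')) else 0) :
    xh ∈ simplex (2 * n) ∧ (∀ i, (∑ i' : Fin n, x (finL i')) * xh i ≤ x i) ∧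
      ∑ i' : Fin n, x (finL i') ≤ 1 := by
  refine ⟨⟨fun i => ?_, ?_⟩, fun i => ?_, ?_⟩
  · rw [hxh]; split_ifs
    · exact div_nonneg (hx.1 i) hpos.le
    · exact le_rfl
  · simp only [hxh]
    rw [aux_sumL (fun i => x i / (∑ i' : Fin n, x (finL i'))), ← Finset.sum_div]
    exact div_self hpos.ne'
  · rw [hxh]; split_ifs
    · rw [mul_div_cancel₀ _ hpos.ne']
    · simpa using hx.1 i
  · rw [← aux_sumL, ← hx.2]
    refine Finset.sum_le_sum fun i _ => ?_
    split_ifs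
    · exact le_rfl
    · exact hx.1 i

theorem aux_entry {n : ℕ} (A : Matrix (Fin n) (Fin n) ℝ)
    (hA01 : ∀ i j, A i j = 0 ∨ A i j = 1) (hAdiag : ∀ i, A i i = 1)
    (γ : ℝ) (hγ : 0 ≤ γ) (i j : Fin n) :
    0 ≤ (1 - A i j) + (γ + 1) * (if (i : ℕ) = (j : ℕ) then 1 else 0) ∧
    (1 - A i j) + (γ + 1) * (if (i : ℕ) = (j : ℕ) then 1 else 0) ≤ 1 + γ := by
  by_cases h : i = j
  · subst h; simp [hAdiag]; constructor <;> linarith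
  · have : (i : ℕ) ≠ j := fun h' => h (Fin.ext h')
    rcases hA01 i j with h0 | h0 <;> simp [this, h0] <;> linarith

theorem aux_R {n : ℕ} (A : Matrix (Fin n) (Fin n) ℝ)
    (hA01 : ∀ i j, A i j = 0 ∨ A i j = 1) (hAdiag : ∀ i, A i i = 1)
    (γ k : ℝ) (hγ : 0 ≤ γ) (hk : 1 + γ ≤ k) (i j : Fin (2 * n)) :
    |ISR n A γ k i j| ≤ k / 2 ∧ |ISC n A γ k i j| ≤ k / 2 ∧
    ISR n A γ k i j + ISC n A γ k i j ≤
      (1 + γ) * ((if (i : ℕ) < n then 1 else 0) * (if (j : ℕ) < n then 1 else 0)) := by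
  unfold ISR ISC
  by_cases hi : (i : ℕ) < n <;> by_cases hj : (j : ℕ) < n
  · obtain ⟨h1, h2⟩ := aux_entry A hA01 hAdiag γ hγ ⟨i, hi⟩ ⟨j, hj⟩
    simp only [hi, hj, dif_pos, if_true, abs_le] at h1 h2 ⊢
    refine ⟨⟨?_, ?_⟩, ⟨?_, ?_⟩, ?_⟩ <;> linarith
  all_goals
    simp only [hi, hj, dif_pos, dif_neg, not_false_eq_true, if_true, if_false, abs_le]
    (try split_ifs) <;> refine ⟨⟨?_, ?_⟩, ⟨?_, ?_⟩, ?_⟩ <;> linarith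

theorem aux_final {T : ℕ} (hT : 0 < T) (k γ ε : ℝ) (s : ℝ) (a d b e : Fin T → ℝ)
    (w : Fin T → ℝ) (hs : ∑ t, (1 - w t) ≤ γ * T) (hk : 0 ≤ k) (hγ : 0 ≤ γ)
    (hab : ∀ t, d t - a t ≤ (e t - b t) + 2 * k * (1 - w t))
    (h : (1 / (T : ℝ)) * ∑ t, b t ≥ (1 / (T : ℝ)) * ∑ t, e t - ε) :
    (1 / (T : ℝ)) * ∑ t, a t ≥ (1 / (T : ℝ)) * ∑ t, d t - (ε + 4 * γ * k) := by
  have hT' : (0 : ℝ) < T := by exact_mod_cast hT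
  have h1 := Finset.sum_le_sum fun t (_ : t ∈ Finset.univ) => hab t
  rw [Finset.sum_add_distrib, Finset.sum_sub_distrib, Finset.sum_sub_distrib,
    ← Finset.mul_sum] at h1
  have h2 : 2 * k * ∑ t, (1 - w t) ≤ 2 * k * (γ * T) :=
    mul_le_mul_of_nonneg_left hs (by linarith)
  have h3 : (1 / (T : ℝ)) * (∑ t, d t - ∑ t, a t)
      ≤ (1 / (T : ℝ)) * ((∑ t, e t - ∑ t, b t) + 2 * k * (γ * T)) :=
    mul_le_mul_of_nonneg_left (by linarith) (by positivity)
  have h4 : (1 / (T : ℝ)) * ((∑ t, e t - ∑ t, b t) + 2 * k * (γ * T))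
      = (1 / (T : ℝ)) * ∑ t, e t - (1 / (T : ℝ)) * ∑ t, b t + 2 * k * γ := by
    field_simp
  rw [h4, mul_sub] at h3
  have := mul_nonneg hγ hk
  nlinarith

/-- renormalizing a high-welfare `ε`-CE of the independent-set game onto the
first `n` actions yields an `(ε + 4γk)`-CE of the same game. -/
theorem renormalized_CE {n T : ℕ} (hT : 0 < T)
    (A : Matrix (Fin n) (Fin n) ℝ)
    (hA01 : ∀ i j, A i j = 0 ∨ A i j = 1)
    (hAsym : ∀ i j, A i j = A j i)
    (hAdiag : ∀ i, A i i = 1)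
    (γ k ε : ℝ) (hγ : 0 ≤ γ) (hk : 1 + γ ≤ k)
    (x y : Fin T → Fin (2 * n) → ℝ)
    (hx : ∀ t, x t ∈ simplex (2 * n)) (hy : ∀ t, y t ∈ simplex (2 * n))
    (hCE : IsSparseCE (ISR n A γ k) (ISC n A γ k) T x y ε)
    (hsw : (1 / (T : ℝ)) *
      ∑ t, x t ⬝ᵥ ((ISR n A γ k) + (ISC n A γ k)).mulVec (y t) ≥ 1)
    (hxpos : ∀ t, 0 < ∑ i : Fin n, x t (finL i))
    (hypos : ∀ t, 0 < ∑ j : Fin n, y t (finL j))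
    (xh yh : Fin T → Fin (2 * n) → ℝ)
    (hxh : ∀ t (i : Fin (2 * n)),
      xh t i = if (i : ℕ) < n then x t i / (∑ i' : Fin n, x t (finL i')) else 0)
    (hyh : ∀ t (j : Fin (2 * n)),
      yh t j = if (j : ℕ) < n then y t j / (∑ j' : Fin n, y t (finL j')) else 0) :
    (∀ t, xh t ∈ simplex (2 * n)) ∧ (∀ t, yh t ∈ simplex (2 * n)) ∧
    IsSparseCE (ISR n A γ k) (ISC n A γ k) T xh yh (ε + 4 * γ * k) := by
  have HX := fun t => aux_hat (x t) (xh t) (hx t) (hxpos t) (hxh t)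
  have HY := fun t => aux_hat (y t) (yh t) (hy t) (hypos t) (hyh t)
  have hE := aux_R A hA01 hAdiag γ k hγ hk
  set p : Fin T → ℝ := fun t => ∑ i : Fin n, x t (finL i) with hp
  set q : Fin T → ℝ := fun t => ∑ i : Fin n, y t (finL i) with hq
  have hpq : ∀ t, p t * q t ≤ 1 := fun t =>
    mul_le_one₀ (HX t).2.2 (hypos t).le (HY t).2.2
  have hT' : (0 : ℝ) < T := by exact_mod_cast hT
  have hw : ∀ t, x t ⬝ᵥ ((ISR n A γ k) + (ISC n A γ k)).mulVec (y t)
      ≤ (1 + γ) * (p t * q t) := by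
    intro t
    rw [aux_form]
    have : (1 + γ) * (p t * q t) = ∑ i : Fin (2 * n), ∑ j : Fin (2 * n), x t i * y t j * ((1 + γ) *
        ((if (i : ℕ) < n then 1 else 0) * (if (j : ℕ) < n then 1 else 0))) := by
      simp only [hp, hq]
      rw [← aux_sumL, ← aux_sumL, Finset.sum_mul_sum, Finset.mul_sum]
      refine Finset.sum_congr rfl fun i _ => ?_
      rw [Finset.mul_sum]
      refine Finset.sum_congr rfl fun j _ => ?_
      split_ifs <;> ring
    rw [this]
    refine Finset.sum_le_sum fun i _ => Finset.sum_le_sum fun j _ => ?_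
    exact mul_le_mul_of_nonneg_left (hE i j).2.2 (mul_nonneg ((hx t).1 i) ((hy t).1 j))
  have hS : ∑ t, (1 - p t * q t) ≤ γ * T := by
    have h1 := Finset.sum_le_sum fun t (_ : t ∈ Finset.univ) => hw t
    have h2 := Finset.sum_le_sum fun t (_ : t ∈ Finset.univ) => hpq t
    rw [← Finset.mul_sum] at h1
    rw [ge_iff_le, one_div, inv_mul_eq_div, le_div_iff₀ hT'] at hsw
    simp only [Finset.sum_sub_distrib, Finset.sum_const, Finset.card_univ, Fintype.card_fin,
      nsmul_eq_mul, mul_one] at h2 ⊢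
    nlinarith
  refine ⟨fun t => (HX t).1, fun t => (HY t).1, fun φx φy hφx hφy => ?_⟩
  obtain ⟨c1, c2⟩ := hCE φx φy hφx hφy
  have hk0 : 0 ≤ k := by linarith
  constructor
  · refine aux_final hT k γ ε 0 _ _ _ _ (fun t => p t * q t) hS hk0 hγ (fun t => ?_) c1
    rw [aux_row_s2, aux_row_s2]
    refine aux_key _ k (fun i j => ?_) _ _ _ _ (hx t) (hy t) (HX t).1 (HY t).1 _ _
      (hxpos t).le (hypos t).le (hpq t) (HX t).2.1 (HY t).2.1
    have h1 := abs_le.1 (hE i j).1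
    have h2 := abs_le.1 (hE (φx i) j).1
    rw [abs_le]; constructor <;> linarith
  · refine aux_final hT k γ ε 0 _ _ _ _ (fun t => p t * q t) hS hk0 hγ (fun t => ?_) c2
    rw [aux_col, aux_col]
    refine aux_key _ k (fun i j => ?_) _ _ _ _ (hx t) (hy t) (HX t).1 (HY t).1 _ _
      (hxpos t).le (hypos t).le (hpq t) (HX t).2.1 (HY t).2.1
    have h1 := abs_le.1 (hE i j).2.1
    have h2 := abs_le.1 (hE i (φy j)).2.1
    rw [abs_le]; constructor <;> linarith
end
end

section
/- Let (R, C) be the 2n×2n independent-set game with parameters γ ≥ 0 and k > 0, and let μ = (1/T) ∑_{t=1}^T x^{(t)} ⊗ y^{(t)} be a uniform T-sparse ε-CCE of (R, C) that is supported only on [n]×[n]. Then for every i, j ∈ [n] and every t ∈ [T], x_i^{(t)} ≤ (1 + γ + 2ε)·T/k and y_j^{(t)} ≤ (1 + γ + 2ε)·T/k. -/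
open Finset Matrix

noncomputable section

theorem bilin_le {m : ℕ} (M : Matrix (Fin m) (Fin m) ℝ) (x y : Fin m → ℝ) (c : ℝ)
    (hx : x ∈ simplex m) (hy : y ∈ simplex m)
    (h : ∀ i j, x i ≠ 0 → y j ≠ 0 → M i j ≤ c) : x ⬝ᵥ M.mulVec y ≤ c := by
  have e : c = ∑ i, ∑ j, x i * (c * y j) := by
    simp_rw [← Finset.mul_sum, hy.2, ← Finset.sum_mul, hx.2]; ring
  rw [e]
  simp only [dotProduct, mulVec, Finset.mul_sum]
  refine Finset.sum_le_sum fun i _ => Finset.sum_le_sum fun j _ => ?_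
  by_cases h1 : x i = 0
  · simp [h1]
  by_cases h2 : y j = 0
  · simp [h2]
  exact mul_le_mul_of_nonneg_left (mul_le_mul_of_nonneg_right (h i j h1 h2) (hy.1 j)) (hx.1 i)

theorem single_mem_simplex {m : ℕ} (a : Fin m) : (Pi.single a 1 : Fin m → ℝ) ∈ simplex m := by
  refine ⟨fun i => ?_, by simp⟩
  by_cases h : i = a
  · subst h; simp
  · simp [h]

theorem block_le {n : ℕ} (A : Matrix (Fin n) (Fin n) ℝ)
    (hA01 : ∀ i j, A i j = 0 ∨ A i j = 1) (hAdiag : ∀ i, A i i = 1)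
    (γ : ℝ) (hγ : 0 ≤ γ) (i j : ℕ) (hi : i < n) (hj : j < n) :
    (1 / 2) * ((1 - A ⟨i, hi⟩ ⟨j, hj⟩) + (γ + 1) * (if i = j then 1 else 0)) ≤ (1 + γ) / 2 := by
  by_cases h : i = j
  · subst h; rw [hAdiag]; simp; linarith
  · rcases hA01 ⟨i, hi⟩ ⟨j, hj⟩ with h' | h' <;> rw [h'] <;> simp [h] <;> linarith

theorem avg_bound {T : ℕ} (hT : 0 < T) (γ k ε : ℝ) (hk : 0 < k) (p q : Fin T → ℝ)
    (hq : ∀ t, 0 ≤ q t) (hp : ∀ t, p t ≤ (1 + γ) / 2)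
    (h : (1 / (T : ℝ)) * ∑ t, p t ≥ (1 / (T : ℝ)) * ∑ t, (1 / 2 * k * q t) - ε) (t : Fin T) :
    q t ≤ (1 + γ + 2 * ε) * (T : ℝ) / k := by
  have hT' : (0 : ℝ) < T := by exact_mod_cast hT
  have h1 : ∑ t, p t ≤ T * ((1 + γ) / 2) := by
    calc ∑ t, p t ≤ ∑ _t : Fin T, (1 + γ) / 2 := Finset.sum_le_sum fun t _ => hp t
      _ = _ := by simp
  have h2 : q t ≤ ∑ t, q t := Finset.single_le_sum (fun t _ => hq t) (Finset.mem_univ t)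
  rw [← Finset.mul_sum] at h
  have h3 : 1 / 2 * k * ∑ t, q t ≤ ∑ t, p t + ε * T := by
    have := mul_le_mul_of_nonneg_right h hT'.le
    field_simp at this
    linarith
  rw [le_div_iff₀ hk]
  nlinarith [mul_le_mul_of_nonneg_left h2 hk.le]

/-- in an `ε`-CCE of the independent-set game supported only on `[n] × [n]`,
every coordinate of every product component is at most `(1 + γ + 2ε)·T/k`. -/
theorem CCE_coordinate_bound {n T : ℕ} (hT : 0 < T)
    (A : Matrix (Fin n) (Fin n) ℝ)
    (hA01 : ∀ i j, A i j = 0 ∨ A i j = 1)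
    (hAsym : ∀ i j, A i j = A j i)
    (hAdiag : ∀ i, A i i = 1)
    (γ k ε : ℝ) (hγ : 0 ≤ γ) (hk : 0 < k)
    (x y : Fin T → Fin (2 * n) → ℝ)
    (hx : ∀ t, x t ∈ simplex (2 * n)) (hy : ∀ t, y t ∈ simplex (2 * n))
    (hCCE : IsSparseCCE (ISR n A γ k) (ISC n A γ k) T x y ε)
    (hsupp : ∀ t (i : Fin (2 * n)), n ≤ (i : ℕ) → x t i = 0 ∧ y t i = 0) :
    ∀ t (i : Fin (2 * n)), (i : ℕ) < n →
      x t i ≤ (1 + γ + 2 * ε) * (T : ℝ) / k ∧ y t i ≤ (1 + γ + 2 * ε) * (T : ℝ) / k := by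
  intro t i hi
  have ha : n + (i : ℕ) < 2 * n := by omega
  constructor
  · refine avg_bound hT γ k ε hk (fun t => x t ⬝ᵥ (ISC n A γ k).mulVec (y t)) (fun t => x t i)
      (fun t => (hx t).1 i) (fun t => ?_) ?_ t
    · refine bilin_le _ _ _ _ (hx t) (hy t) fun a b h1 h2 => ?_
      have ha : (a : ℕ) < n := by
        by_contra h; exact h1 (hsupp t a (by omega)).1
      have hb : (b : ℕ) < n := by
        by_contra h; exact h2 (hsupp t b (by omega)).2
      simp only [ISC, ha, hb, dif_pos]
      exact block_le A hA01 hAdiag γ hγ a b ha hb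
    · have := hCCE.2 (Pi.single ⟨n + i, ha⟩ 1) (single_mem_simplex _)
      convert this using 5 with s
      rw [Matrix.mulVec_single_one, dotProduct, Finset.sum_eq_single i]
      · simp [ISC, hi, add_comm]; ring
      · intro b _ hb
        by_cases hbn : (b : ℕ) < n
        · have : ¬ ((b : ℕ) + n = n + i) := fun h => hb (Fin.ext (by omega))
          simp [ISC, hbn, this]
        · rw [(hsupp s b (by omega)).1, zero_mul]
      · simp
  · refine avg_bound hT γ k ε hk (fun t => x t ⬝ᵥ (ISR n A γ k).mulVec (y t)) (fun t => y t i)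
      (fun t => (hy t).1 i) (fun t => ?_) ?_ t
    · refine bilin_le _ _ _ _ (hx t) (hy t) fun a b h1 h2 => ?_
      have ha : (a : ℕ) < n := by
        by_contra h; exact h1 (hsupp t a (by omega)).1
      have hb : (b : ℕ) < n := by
        by_contra h; exact h2 (hsupp t b (by omega)).2
      simp only [ISR, ha, hb, dif_pos]
      exact block_le A hA01 hAdiag γ hγ a b ha hb
    · have := hCCE.1 (Pi.single ⟨n + i, ha⟩ 1) (single_mem_simplex _)
      convert this using 5 with s
      rw [single_one_dotProduct, mulVec, dotProduct, Finset.sum_eq_single i]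
      · simp [ISR, hi, add_comm]
      · intro b _ hb
        by_cases hbn : (b : ℕ) < n
        · have : ¬ (n + (i : ℕ) = b + n) := fun h => hb (Fin.ext (by omega))
          simp [ISR, hbn, this]
        · rw [(hsupp s b (by omega)).2, mul_zero]
      · simp
end
end

section
/- Let G be an n-node graph, let k ≥ 1 and let T ≥ 1 be an integer, and set γ = 1/(256·k·T³). If the 2n×2n independent-set game (R, C) with parameters γ, k admits a uniform T-sparse (1/4)-CE supported only on [n]×[n] whose welfare is at least 1 + 3γ/(4k), then G contains an independent set of size at least k/(16T²). -/
open Finset Matrix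

noncomputable section

theorem core_lemma {n : ℕ} (A : Matrix (Fin n) (Fin n) ℝ)
    (hA01 : ∀ i j, A i j = 0 ∨ A i j = 1)
    (hAsym : ∀ i j, A i j = A j i)
    (hAdiag : ∀ i, A i i = 1)
    (k γ T : ℝ) (hT : 1 ≤ T) (hk : 1 ≤ k) (hγ : γ = 1 / (256 * k * T ^ 3))
    (u v : Fin n → ℝ) (hu : ∀ i, 0 ≤ u i) (hv : ∀ i, 0 ≤ v i)
    (hu1 : ∑ i, u i = 1) (hv1 : ∑ i, v i = 1)
    (hub : ∀ i, u i * k ≤ (8 / 5) * T) (hvb : ∀ i, v i * k ≤ (8 / 5) * T)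
    (h : 1 + 3 * γ / (4 * k) ≤ ∑ i, ∑ j, u i * (1 - A i j + (γ + 1) * (if i = j then 1 else 0)) * v j) :
    ∃ S : Finset (Fin n), IsIndepSet A S ∧ k / (16 * T ^ 2) ≤ (S.card : ℝ) := by
  have hk0 : 0 < k := by linarith
  have hT0 : 0 < T := by linarith
  have hγ0 : 0 < γ := by rw [hγ]; positivity
  set P := ∑ i, u i * v i with hP
  set E := ∑ i, ∑ j, u i * (A i j - (if i = j then 1 else 0)) * v j with hE
  have hB : ∀ i j, 0 ≤ A i j - (if i = j then 1 else 0) := by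
    intro i j
    split_ifs with hij
    · subst hij; rw [hAdiag]; simp
    · rcases hA01 i j with h | h <;> rw [h] <;> norm_num
  have key : ∑ i, ∑ j, u i * (1 - A i j + (γ + 1) * (if i = j then 1 else 0)) * v j
      = 1 - E + γ * P := by
    have e1 : ∑ i, ∑ j, u i * v j = 1 := by
      rw [← Finset.sum_mul_sum, hu1, hv1]; norm_num
    have e2 : P = ∑ i, ∑ j, u i * (if i = j then 1 else 0) * v j := by
      simp [hP]
    have e3 : 1 - E + γ * P = (∑ i, ∑ j, u i * v j) - E + γ * P := by rw [e1]
    rw [e3, e2, hE, Finset.mul_sum, ← Finset.sum_sub_distrib, ← Finset.sum_add_distrib]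
    refine Finset.sum_congr rfl fun i _ => ?_
    rw [Finset.mul_sum, ← Finset.sum_sub_distrib, ← Finset.sum_add_distrib]
    refine Finset.sum_congr rfl fun j _ => ?_
    ring
  rw [key] at h
  have hterm : ∀ i j, 0 ≤ u i * (A i j - (if i = j then 1 else 0)) * v j := fun i j =>
    mul_nonneg (mul_nonneg (hu i) (hB i j)) (hv j)
  have hE0 : 0 ≤ E := Finset.sum_nonneg fun i _ => Finset.sum_nonneg fun j _ => hterm i j
  have hPk : 3 / 4 ≤ P * k := by
    have h1 : γ * (3 / (4 * k)) ≤ γ * P := by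
      have : γ * (3 / (4 * k)) = 3 * γ / (4 * k) := by ring
      linarith
    have h2 := le_of_mul_le_mul_left h1 hγ0
    rw [div_le_iff₀ (by positivity)] at h2
    linarith
  have hEP : E ≤ γ * P := by
    have : 0 ≤ 3 * γ / (4 * k) := by positivity
    linarith
  have hPT : P * k ≤ (8 / 5) * T := by
    have : P * k ≤ ∑ i, (8 / 5) * T * v i := by
      rw [hP, Finset.sum_mul]
      refine Finset.sum_le_sum fun i _ => ?_
      have := mul_le_mul_of_nonneg_right (hub i) (hv i)
      linarith
    rw [← Finset.mul_sum, hv1] at this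
    linarith
  have hs : E < 2 * (1 / (16 * k)) ^ 2 := by
    have e : γ * P ≤ (8 / 5) / (256 * k ^ 2) := by
      have e1 : γ * P = (P * k) / (256 * k ^ 2 * T ^ 3) := by
        rw [hγ]; field_simp
      rw [e1, div_le_div_iff₀ (by positivity) (by positivity)]
      have h3 : T ≤ T ^ 3 := le_self_pow₀ hT (by norm_num)
      have h4 : P * k ≤ 8 / 5 * T ^ 3 := by linarith
      have := mul_le_mul_of_nonneg_right h4 (by positivity : 0 ≤ 256 * k ^ 2)
      linarith
    have : 2 * (1 / (16 * k)) ^ 2 = 2 / (256 * k ^ 2) := by field_simp; norm_num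
    rw [this]
    refine lt_of_le_of_lt (hEP.trans e) ?_
    gcongr
    norm_num
  set s := 1 / (16 * k) with hsdef
  have hs0 : 0 < s := by positivity
  refine ⟨Finset.univ.filter fun i => s ^ 2 ≤ u i * v i, ?_, ?_⟩
  · intro i hi j hj hij
    simp only [Finset.mem_filter, Finset.mem_univ, true_and] at hi hj
    rcases hA01 i j with h0 | h1
    · exact h0
    exfalso
    have h1' : A j i = 1 := by rw [hAsym, h1]
    have row : ∀ a b, u a * (A a b - (if a = b then 1 else 0)) * v b ≤
        ∑ j, u a * (A a j - (if a = j then 1 else 0)) * v j := fun a b =>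
      Finset.single_le_sum (f := fun j => u a * (A a j - (if a = j then 1 else 0)) * v j)
        (fun j _ => hterm a j) (Finset.mem_univ b)
    have two : (∑ l, u i * (A i l - (if i = l then 1 else 0)) * v l) +
        (∑ l, u j * (A j l - (if j = l then 1 else 0)) * v l) ≤ E := by
      have := Finset.sum_le_sum_of_subset_of_nonneg
        (f := fun a => ∑ l, u a * (A a l - (if a = l then 1 else 0)) * v l)
        (Finset.subset_univ {i, j}) (fun a _ _ => Finset.sum_nonneg fun l _ => hterm a l)
      rwa [Finset.sum_pair hij] at this
    have r1 := row i j
    have r2 := row j i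
    rw [h1, if_neg hij] at r1
    rw [h1', if_neg (Ne.symm hij)] at r2
    have hlt : u i * v j + u j * v i < 2 * s ^ 2 := by linarith
    have hpp : (s ^ 2) * (s ^ 2) ≤ (u i * v j) * (u j * v i) := by
      have := mul_le_mul hi hj (by positivity) (mul_nonneg (hu i) (hv i))
      linarith
    have ha := mul_nonneg (hu i) (hv j)
    have hb := mul_nonneg (hu j) (hv i)
    nlinarith [sq_nonneg (u i * v j - u j * v i), sq_nonneg s]
  · set S := Finset.univ.filter fun i => s ^ 2 ≤ u i * v i with hS
    set m := (8 / 5) * T / k with hm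
    have hm0 : 0 < m := by positivity
    have hum : ∀ i, u i ≤ m := fun i => by rw [hm, le_div_iff₀ hk0]; exact hub i
    have hvm : ∀ i, v i ≤ m := fun i => by rw [hm, le_div_iff₀ hk0]; exact hvb i
    have hsplit : P = ∑ i ∈ S, u i * v i +
        ∑ i ∈ Finset.univ.filter (fun i => ¬ s ^ 2 ≤ u i * v i), u i * v i :=
      (Finset.sum_filter_add_sum_filter_not _ _ _).symm
    have hA : ∑ i ∈ S, u i * v i ≤ S.card * m ^ 2 := by
      rw [← nsmul_eq_mul]
      refine Finset.sum_le_card_nsmul _ _ _ fun i _ => ?_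
      rw [sq]
      exact mul_le_mul (hum i) (hvm i) (hv i) hm0.le
    have hR : ∑ i ∈ Finset.univ.filter (fun i => ¬ s ^ 2 ≤ u i * v i), u i * v i ≤ 2 * s := by
      have e1 : ∑ i ∈ Finset.univ.filter (fun i => ¬ s ^ 2 ≤ u i * v i), u i * v i ≤
          ∑ i ∈ Finset.univ.filter (fun i => ¬ s ^ 2 ≤ u i * v i), s * (u i + v i) := by
        refine Finset.sum_le_sum fun i hi => ?_
        simp only [Finset.mem_filter, Finset.mem_univ, true_and, not_le] at hi
        by_cases hc : u i ≤ s
        · nlinarith [mul_le_mul_of_nonneg_right hc (hv i), mul_nonneg hs0.le (hu i)]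
        · have : v i ≤ s := by
            by_contra hc'
            push Not at hc hc'
            nlinarith
          nlinarith [mul_le_mul_of_nonneg_left this (hu i), mul_nonneg hs0.le (hv i)]
      have e2 : ∑ i ∈ Finset.univ.filter (fun i => ¬ s ^ 2 ≤ u i * v i), s * (u i + v i) ≤
          ∑ i, s * (u i + v i) :=
        Finset.sum_le_sum_of_subset_of_nonneg (Finset.filter_subset _ _)
          fun i _ _ => mul_nonneg hs0.le (add_nonneg (hu i) (hv i))
      have e3 : ∑ i, s * (u i + v i) = 2 * s := by
        rw [← Finset.mul_sum, Finset.sum_add_distrib, hu1, hv1]; ring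
      linarith
    have hmain : P ≤ S.card * m ^ 2 + 2 * s := by linarith
    have hmain2 : P * k ≤ S.card * (64 / 25 * T ^ 2 / k) + 1 / 8 := by
      have := mul_le_mul_of_nonneg_right hmain hk0.le
      have e : (S.card * m ^ 2 + 2 * s) * k = S.card * (64 / 25 * T ^ 2 / k) + 1 / 8 := by
        rw [hm, hsdef]; field_simp; ring
      linarith
    have h5 : 5 / 8 ≤ (S.card : ℝ) * (64 / 25 * T ^ 2) / k := by
      have : (S.card : ℝ) * (64 / 25 * T ^ 2 / k) = (S.card : ℝ) * (64 / 25 * T ^ 2) / k := by ring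
      linarith
    rw [le_div_iff₀ hk0] at h5
    rw [div_le_iff₀ (by positivity)]
    linarith

theorem finL_lt {n : ℕ} (i : Fin n) : ((finL i : Fin (2 * n)) : ℕ) < n := i.isLt

theorem sum_supp {n : ℕ} (f : Fin (2 * n) → ℝ) (hf : ∀ i : Fin (2 * n), n ≤ (i : ℕ) → f i = 0) :
    ∑ i, f i = ∑ i : Fin n, f (finL i) := by
  symm
  refine Finset.sum_of_injOn finL ?_ ?_ ?_ ?_
  · intro a _ b _ hab
    exact Fin.ext (by simpa [finL] using hab)
  · intro a _; simp
  · intro i _ hi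
    apply hf
    by_contra hc
    push Not at hc
    exact hi ⟨⟨i, hc⟩, by simp, rfl⟩
  · intro _ _; rfl

theorem dot_supp {n : ℕ} (M : Matrix (Fin (2 * n)) (Fin (2 * n)) ℝ) (x y : Fin (2 * n) → ℝ)
    (h : ∀ (i : Fin (2 * n)), n ≤ (i : ℕ) → x i = 0 ∧ y i = 0) :
    x ⬝ᵥ M.mulVec y = ∑ i : Fin n, ∑ j : Fin n, x (finL i) * M (finL i) (finL j) * y (finL j) := by
  unfold dotProduct
  rw [sum_supp _ (fun i hi => by rw [(h i hi).1, zero_mul])]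
  refine Finset.sum_congr rfl fun i _ => ?_
  unfold Matrix.mulVec dotProduct
  rw [sum_supp _ (fun i hi => by rw [(h i hi).2, mul_zero]), Finset.mul_sum]
  refine Finset.sum_congr rfl fun j _ => ?_
  ring

theorem ISR_LL {n : ℕ} (A : Matrix (Fin n) (Fin n) ℝ) (γ k : ℝ) (i j : Fin n) :
    ISR n A γ k (finL i) (finL j) =
      (1 / 2) * (1 - A i j + (γ + 1) * (if i = j then 1 else 0)) := by
  by_cases h : i = j
  · subst h; simp [ISR, finL]
  · have h' : (i : ℕ) ≠ j := fun e => h (Fin.ext e)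
    simp [ISR, finL, h, h']

theorem ISC_LL {n : ℕ} (A : Matrix (Fin n) (Fin n) ℝ) (γ k : ℝ) (i j : Fin n) :
    ISC n A γ k (finL i) (finL j) =
      (1 / 2) * (1 - A i j + (γ + 1) * (if i = j then 1 else 0)) := by
  by_cases h : i = j
  · subst h; simp [ISC, finL]
  · have h' : (i : ℕ) ≠ j := fun e => h (Fin.ext e)
    simp [ISC, finL, h, h']

theorem ISR_RL {n : ℕ} (A : Matrix (Fin n) (Fin n) ℝ) (γ k : ℝ) (i j : Fin n) :
    ISR n A γ k (finR i) (finL j) = (k / 2) * (if i = j then 1 else 0) := by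
  simp [ISR, finL, finR, Fin.ext_iff, add_comm n]
  split_ifs <;> ring

theorem ISC_LR {n : ℕ} (A : Matrix (Fin n) (Fin n) ℝ) (γ k : ℝ) (i j : Fin n) :
    ISC n A γ k (finL i) (finR j) = (k / 2) * (if i = j then 1 else 0) := by
  simp [ISC, finL, finR, Fin.ext_iff, add_comm n]
  split_ifs <;> ring

theorem dev_const {m : ℕ} (c : Fin m) (x : Fin m → ℝ) (hx : x ∈ simplex m) :
    devApply (fun _ => c) x = Pi.single c 1 := by
  funext i
  unfold devApply
  by_cases h : c = i
  · subst h; simp [hx.2]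
  · simp [h, Pi.single_apply, Ne.symm h]

theorem inPhi_const {n : ℕ} (j : Fin n) : InPhi (fun _ : Fin (2 * n) => finR j) := by
  left
  have := j.isLt
  refine ⟨finR j, ⟨2 * n - 1, by omega⟩, fun i => ⟨fun _ => rfl, fun h => ?_⟩⟩
  exfalso
  have := i.isLt
  rw [Fin.lt_def] at h
  simp at h
  omega

theorem bil_le {n : ℕ} (A : Matrix (Fin n) (Fin n) ℝ)
    (hA01 : ∀ i j, A i j = 0 ∨ A i j = 1) (hAdiag : ∀ i, A i i = 1) (γ : ℝ) (hγ : 0 ≤ γ)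
    (u v : Fin n → ℝ) (hu : ∀ i, 0 ≤ u i) (hv : ∀ i, 0 ≤ v i)
    (hu1 : ∑ i, u i = 1) (hv1 : ∑ i, v i = 1) :
    ∑ i, ∑ j, u i * (1 - A i j + (γ + 1) * (if i = j then 1 else 0)) * v j ≤ 1 + γ := by
  have e1 : ∑ i, ∑ j, u i * (1 + γ) * v j = 1 + γ := by
    rw [← Finset.sum_mul_sum, ← Finset.sum_mul, hu1, hv1]; ring
  rw [← e1]
  refine Finset.sum_le_sum fun i _ => Finset.sum_le_sum fun j _ => ?_
  refine mul_le_mul_of_nonneg_right (mul_le_mul_of_nonneg_left ?_ (hu i)) (hv j)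
  split_ifs with hij
  · subst hij; rw [hAdiag]; linarith
  · rcases hA01 i j with h | h <;> rw [h] <;> linarith

/-- if the independent-set game with `γ = 1/(256·k·T³)` admits a uniform
`T`-sparse `(1/4)`-CE supported only on `[n] × [n]` with welfare at least `1 + 3γ/(4k)`,
then the graph contains an independent set of size at least `k/(16T²)`. -/
theorem sparseCE_gives_indepSet {n T : ℕ} (hT : 1 ≤ T)
    (A : Matrix (Fin n) (Fin n) ℝ)
    (hA01 : ∀ i j, A i j = 0 ∨ A i j = 1)
    (hAsym : ∀ i j, A i j = A j i)
    (hAdiag : ∀ i, A i i = 1)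
    (k γ : ℝ) (hk : 1 ≤ k) (hγ : γ = 1 / (256 * k * (T : ℝ) ^ 3))
    (x y : Fin T → Fin (2 * n) → ℝ)
    (hx : ∀ t, x t ∈ simplex (2 * n)) (hy : ∀ t, y t ∈ simplex (2 * n))
    (hCE : IsSparseCE (ISR n A γ k) (ISC n A γ k) T x y (1 / 4))
    (hsupp : ∀ t (i : Fin (2 * n)), n ≤ (i : ℕ) → x t i = 0 ∧ y t i = 0)
    (hsw : (1 / (T : ℝ)) *
      ∑ t, x t ⬝ᵥ ((ISR n A γ k) + (ISC n A γ k)).mulVec (y t) ≥ 1 + 3 * γ / (4 * k)) :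
    ∃ S : Finset (Fin n), IsIndepSet A S ∧ k / (16 * (T : ℝ) ^ 2) ≤ (S.card : ℝ) := by
  have hTr : (1 : ℝ) ≤ T := by exact_mod_cast hT
  have hT0 : (0 : ℝ) < T := by linarith
  have hk0 : 0 < k := by linarith
  have hγ0 : 0 < γ := by rw [hγ]; positivity
  have hγ1 : γ ≤ 1 / 256 := by
    rw [hγ]
    apply one_div_le_one_div_of_le (by norm_num)
    have : 1 ≤ k * (T : ℝ) ^ 3 := one_le_mul_of_one_le_of_one_le hk (one_le_pow₀ hTr)
    linarith
  let W : Fin T → ℝ := fun t => ∑ i : Fin n, ∑ j : Fin n, x t (finL i) *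
    (1 - A i j + (γ + 1) * (if i = j then 1 else 0)) * y t (finL j)
  have hx1 : ∀ t, ∑ i : Fin n, x t (finL i) = 1 := fun t => by
    rw [← sum_supp (x t) fun i hi => (hsupp t i hi).1]; exact (hx t).2
  have hy1 : ∀ t, ∑ i : Fin n, y t (finL i) = 1 := fun t => by
    rw [← sum_supp (y t) fun i hi => (hsupp t i hi).2]; exact (hy t).2
  have hWle : ∀ t, W t ≤ 1 + γ := fun t =>
    bil_le A hA01 hAdiag γ hγ0.le _ _ (fun i => (hx t).1 _) (fun i => (hy t).1 _) (hx1 t) (hy1 t)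
  have hRW : ∀ t, x t ⬝ᵥ (ISR n A γ k).mulVec (y t) = (1 / 2) * W t := fun t => by
    rw [dot_supp _ _ _ (hsupp t), Finset.mul_sum]
    refine Finset.sum_congr rfl fun i _ => ?_
    rw [Finset.mul_sum]
    refine Finset.sum_congr rfl fun j _ => ?_
    rw [ISR_LL]; ring
  have hCW : ∀ t, x t ⬝ᵥ (ISC n A γ k).mulVec (y t) = (1 / 2) * W t := fun t => by
    rw [dot_supp _ _ _ (hsupp t), Finset.mul_sum]
    refine Finset.sum_congr rfl fun i _ => ?_
    rw [Finset.mul_sum]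
    refine Finset.sum_congr rfl fun j _ => ?_
    rw [ISC_LL]; ring
  have hsumW : ∑ t, W t ≤ T * (1 + γ) := by
    have := Finset.sum_le_card_nsmul Finset.univ W (1 + γ) fun t _ => hWle t
    simp only [Finset.card_univ, Fintype.card_fin, nsmul_eq_mul] at this
    exact this
  have hbound : ∀ j : Fin n, (∑ t, y t (finL j)) * k ≤ (8 / 5) * T ∧
      (∑ t, x t (finL j)) * k ≤ (8 / 5) * T := by
    intro j
    obtain ⟨h1, h2⟩ := hCE _ _ (inPhi_const j) (inPhi_const j)
    have d1 : ∀ t, devApply (fun _ => finR j) (x t) ⬝ᵥ (ISR n A γ k).mulVec (y t)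
        = (k / 2) * y t (finL j) := fun t => by
      rw [dev_const _ _ (hx t), single_one_dotProduct]
      unfold Matrix.mulVec dotProduct
      rw [sum_supp _ fun i hi => by rw [(hsupp t i hi).2, mul_zero]]
      simp [ISR_RL]
    have d2 : ∀ t, x t ⬝ᵥ (ISC n A γ k).mulVec (devApply (fun _ => finR j) (y t))
        = (k / 2) * x t (finL j) := fun t => by
      rw [dev_const _ _ (hy t), Matrix.mulVec_single_one]
      unfold dotProduct
      rw [sum_supp _ fun i hi => by rw [(hsupp t i hi).1, zero_mul]]
      simp [ISC_LR, mul_comm]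
    simp only [hRW, d1] at h1
    simp only [hCW, d2] at h2
    rw [← Finset.mul_sum, ← Finset.mul_sum] at h1 h2
    have aux : ∀ a : ℝ, (1 / (T : ℝ)) * ((1 / 2) * ∑ t, W t) ≥
        (1 / (T : ℝ)) * (k / 2 * a) - 1 / 4 → a * k ≤ (8 / 5) * T := by
      intro a h
      have h' := mul_le_mul_of_nonneg_left h hT0.le
      have e1 : (T : ℝ) * ((1 / (T : ℝ)) * (k / 2 * a) - 1 / 4) = k / 2 * a - T / 4 := by
        field_simp
      have e2 : (T : ℝ) * ((1 / (T : ℝ)) * ((1 / 2) * ∑ t, W t)) = (1 / 2) * ∑ t, W t := by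
        field_simp
      rw [e1, e2] at h'
      have := mul_le_mul_of_nonneg_left hγ1 hT0.le
      linarith
    exact ⟨aux _ h1, aux _ h2⟩
  have hex : ∃ t, 1 + 3 * γ / (4 * k) ≤ W t := by
    by_contra hc
    push Not at hc
    have hs : ∀ t, x t ⬝ᵥ ((ISR n A γ k) + (ISC n A γ k)).mulVec (y t) = W t := fun t => by
      rw [Matrix.add_mulVec, dotProduct_add, hRW, hCW]; ring
    simp only [hs] at hsw
    have hlt : ∑ t, W t < ∑ _t : Fin T, (1 + 3 * γ / (4 * k)) :=
      Finset.sum_lt_sum_of_nonempty ⟨⟨0, hT⟩, Finset.mem_univ _⟩ fun t _ => hc t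
    simp only [Finset.sum_const, Finset.card_univ, Fintype.card_fin, nsmul_eq_mul] at hlt
    have h' := mul_le_mul_of_nonneg_left hsw hT0.le
    have e2 : (T : ℝ) * ((1 / (T : ℝ)) * ∑ t, W t) = ∑ t, W t := by field_simp
    linarith
  obtain ⟨t, ht⟩ := hex
  refine core_lemma A hA01 hAsym hAdiag k γ T hTr hk hγ (fun i => x t (finL i))
    (fun i => y t (finL i)) (fun i => (hx t).1 _) (fun i => (hy t).1 _) (hx1 t) (hy1 t)
    (fun j => ?_) (fun j => ?_) ht
  · refine le_trans (mul_le_mul_of_nonneg_right ?_ hk0.le) (hbound j).2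
    exact Finset.single_le_sum (f := fun t => x t (finL j)) (fun s _ => (hx s).1 _)
      (Finset.mem_univ t)
  · refine le_trans (mul_le_mul_of_nonneg_right ?_ hk0.le) (hbound j).1
    exact Finset.single_le_sum (f := fun t => y t (finL j)) (fun s _ => (hy s).1 _)
      (Finset.mem_univ t)
end
end

section
/- Let G be an n-node graph, let k ≥ 1 and let T ≥ 1 be an integer, and set γ = 1/(256·k·T³). If the 2n×2n independent-set game (R, C) with parameters γ, k admits a uniform T-sparse (1/(4k²))-CE supported only on [n]×[n] whose welfare is at least 1 + 3γ/(4k), then G contains an independent set of size at least k/(16T). -/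
open Finset Matrix

noncomputable section

lemma dot_devApply {m : ℕ} (φ : Fin m → Fin m) (x v : Fin m → ℝ) :
    devApply φ x ⬝ᵥ v = ∑ i, x i * v (φ i) := by
  simp only [dotProduct, devApply, Finset.sum_mul]
  rw [Finset.sum_comm]
  refine Finset.sum_congr rfl fun i _ => ?_
  simp [ite_mul]

lemma ISR_mulVec_R {n : ℕ} (A : Matrix (Fin n) (Fin n) ℝ) (γ k : ℝ) (y : Fin (2 * n) → ℝ)
    (hs : ∀ i : Fin (2 * n), n ≤ (i : ℕ) → y i = 0) (i : Fin n) :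
    (ISR n A γ k).mulVec y (finR i) = k / 2 * y (finL i) := by
  simp only [Matrix.mulVec, dotProduct]
  rw [Finset.sum_eq_single (finL i)]
  · simp [ISR, finR, finL, add_comm]; ring_nf; simp
  · intro j _ hj
    by_cases h : (j : ℕ) < n
    · have : ¬ (n + (i : ℕ) = (j : ℕ) + n) := by
        intro h'; apply hj; apply Fin.ext; simp [finL]; omega
      simp [ISR, finR, h, this]
    · rw [hs j (by omega)]; simp
  · simp

lemma ISC_vecMul_R {n : ℕ} (A : Matrix (Fin n) (Fin n) ℝ) (γ k : ℝ) (x : Fin (2 * n) → ℝ)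
    (hs : ∀ i : Fin (2 * n), n ≤ (i : ℕ) → x i = 0) (i : Fin n) :
    Matrix.vecMul x (ISC n A γ k) (finR i) = k / 2 * x (finL i) := by
  simp only [Matrix.vecMul, dotProduct]
  rw [Finset.sum_eq_single (finL i)]
  · simp [ISC, finR, finL, add_comm]; ring_nf
  · intro j _ hj
    by_cases h : (j : ℕ) < n
    · have : ¬ ((j : ℕ) + n = n + (i : ℕ)) := by
        intro h'; apply hj; apply Fin.ext; simp [finL]; omega
      simp [ISC, finR, h, this]
    · rw [hs j (by omega)]; simp
  · simp

lemma IS_entry {n : ℕ} (A : Matrix (Fin n) (Fin n) ℝ)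
    (hA01 : ∀ i j, A i j = 0 ∨ A i j = 1) (hAdiag : ∀ i, A i i = 1) (γ k : ℝ)
    (i j : Fin (2 * n)) (hi : (i : ℕ) < n) (hj : (j : ℕ) < n) :
    ISR n A γ k i j ≤ (1 / 2) * (1 + γ * (if i = j then 1 else 0)) ∧
    ISC n A γ k i j = ISR n A γ k i j := by
  constructor
  · by_cases h : i = j
    · subst h
      simp [ISR, hi, hAdiag]; linarith
    · have h' : ¬ ((i : ℕ) = (j : ℕ)) := fun h' => h (Fin.ext h')
      rcases hA01 ⟨i, hi⟩ ⟨j, hj⟩ with h0 | h0 <;> simp [ISR, hi, hj, h, h', h0]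
  · simp [ISR, ISC, hi, hj]

lemma ISR_mulVec_le {n : ℕ} (A : Matrix (Fin n) (Fin n) ℝ)
    (hA01 : ∀ i j, A i j = 0 ∨ A i j = 1) (hAdiag : ∀ i, A i i = 1) (γ k : ℝ) (hγ : 0 ≤ γ)
    (y : Fin (2 * n) → ℝ) (hy : y ∈ simplex (2 * n))
    (hs : ∀ i : Fin (2 * n), n ≤ (i : ℕ) → y i = 0) (i : Fin (2 * n)) (hi : (i : ℕ) < n) :
    (ISR n A γ k).mulVec y i ≤ (1 + γ) / 2 := by
  simp only [Matrix.mulVec, dotProduct]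
  calc _ ≤ ∑ j, (1 + γ) / 2 * y j := by
        refine Finset.sum_le_sum fun j _ => ?_
        by_cases h : (j : ℕ) < n
        · refine mul_le_mul_of_nonneg_right ?_ (hy.1 j)
          have := (IS_entry A hA01 hAdiag γ k i j hi h).1
          split_ifs at this <;> linarith
        · rw [hs j (by omega)]; simp
    _ = _ := by rw [← Finset.mul_sum, hy.2, mul_one]

lemma ISC_vecMul_le {n : ℕ} (A : Matrix (Fin n) (Fin n) ℝ)
    (hA01 : ∀ i j, A i j = 0 ∨ A i j = 1) (hAdiag : ∀ i, A i i = 1) (γ k : ℝ) (hγ : 0 ≤ γ)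
    (x : Fin (2 * n) → ℝ) (hx : x ∈ simplex (2 * n))
    (hs : ∀ i : Fin (2 * n), n ≤ (i : ℕ) → x i = 0) (i : Fin (2 * n)) (hi : (i : ℕ) < n) :
    Matrix.vecMul x (ISC n A γ k) i ≤ (1 + γ) / 2 := by
  simp only [Matrix.vecMul, dotProduct]
  calc _ ≤ ∑ j, x j * ((1 + γ) / 2) := by
        refine Finset.sum_le_sum fun j _ => ?_
        by_cases h : (j : ℕ) < n
        · refine mul_le_mul_of_nonneg_left ?_ (hx.1 j)
          have := (IS_entry A hA01 hAdiag γ k j i h hi)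
          have h1 := this.1
          rw [this.2]
          split_ifs at h1 <;> linarith
        · rw [hs j (by omega)]; simp
    _ = _ := by rw [← Finset.sum_mul, hx.2, one_mul]

/-- welfare bound without edges -/
lemma welfare_le {n : ℕ} (A : Matrix (Fin n) (Fin n) ℝ)
    (hA01 : ∀ i j, A i j = 0 ∨ A i j = 1) (hAdiag : ∀ i, A i i = 1) (γ k : ℝ)
    (x y : Fin (2 * n) → ℝ) (hx : x ∈ simplex (2 * n)) (hy : y ∈ simplex (2 * n))
    (hsx : ∀ i : Fin (2 * n), n ≤ (i : ℕ) → x i = 0)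
    (hsy : ∀ i : Fin (2 * n), n ≤ (i : ℕ) → y i = 0) :
    x ⬝ᵥ ((ISR n A γ k) + (ISC n A γ k)).mulVec y ≤ 1 + γ * ∑ i, x i * y i := by
  have e : (1 : ℝ) + γ * ∑ i, x i * y i
      = ∑ i, x i * ∑ j, (1 + γ * (if i = j then 1 else 0)) * y j := by
    have : ∀ i, ∑ j, (1 + γ * (if i = j then (1:ℝ) else 0)) * y j = 1 + γ * y i := by
      intro i
      simp [add_mul, Finset.sum_add_distrib, hy.2]
    simp only [this, mul_add, mul_one, Finset.sum_add_distrib, hx.2, Finset.mul_sum]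
    congr 1
    exact Finset.sum_congr rfl fun i _ => by ring
  rw [e]
  simp only [Matrix.mulVec, dotProduct]
  refine Finset.sum_le_sum fun i _ => ?_
  by_cases hi : (i : ℕ) < n
  · refine mul_le_mul_of_nonneg_left (Finset.sum_le_sum fun j _ => ?_) (hx.1 i)
    by_cases hj : (j : ℕ) < n
    · refine mul_le_mul_of_nonneg_right ?_ (hy.1 j)
      obtain ⟨h1, h2⟩ := IS_entry A hA01 hAdiag γ k i j hi hj
      rw [Matrix.add_apply, h2]; linarith
    · rw [hsy j (by omega)]; simp
  · rw [hsx i (by omega)]; simp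

/-- welfare bound with one edge -/
lemma welfare_edge_le {n : ℕ} (A : Matrix (Fin n) (Fin n) ℝ)
    (hA01 : ∀ i j, A i j = 0 ∨ A i j = 1) (hAdiag : ∀ i, A i i = 1) (γ k : ℝ)
    (x y : Fin (2 * n) → ℝ) (hx : x ∈ simplex (2 * n)) (hy : y ∈ simplex (2 * n))
    (hsx : ∀ i : Fin (2 * n), n ≤ (i : ℕ) → x i = 0)
    (hsy : ∀ i : Fin (2 * n), n ≤ (i : ℕ) → y i = 0)
    (a b : Fin n) (hab : a ≠ b) (hE : A a b = 1) :
    x ⬝ᵥ ((ISR n A γ k) + (ISC n A γ k)).mulVec y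
      ≤ 1 + γ * ∑ i, x i * y i - x (finL a) * y (finL b) := by
  have e : (1 : ℝ) + γ * ∑ i, x i * y i - x (finL a) * y (finL b)
      = ∑ i, x i * ∑ j, (1 + γ * (if i = j then 1 else 0)
        - (if i = finL a then (if j = finL b then 1 else 0) else 0)) * y j := by
    have : ∀ i, ∑ j, (1 + γ * (if i = j then (1:ℝ) else 0)
        - (if i = finL a then (if j = finL b then 1 else 0) else 0)) * y j
        = 1 + γ * y i - (if i = finL a then y (finL b) else 0) := by
      intro i
      by_cases h : i = finL a <;>
        simp [h, add_mul, sub_mul, Finset.sum_add_distrib, Finset.sum_sub_distrib, hy.2]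
    simp only [this, mul_add, mul_sub, mul_one, Finset.sum_add_distrib, Finset.sum_sub_distrib,
      hx.2, Finset.mul_sum]
    congr 1
    · congr 1
      exact Finset.sum_congr rfl fun i _ => by ring
    · simp
  rw [e]
  simp only [Matrix.mulVec, dotProduct]
  refine Finset.sum_le_sum fun i _ => ?_
  by_cases hi : (i : ℕ) < n
  · refine mul_le_mul_of_nonneg_left (Finset.sum_le_sum fun j _ => ?_) (hx.1 i)
    by_cases hj : (j : ℕ) < n
    · refine mul_le_mul_of_nonneg_right ?_ (hy.1 j)
      obtain ⟨h1, h2⟩ := IS_entry A hA01 hAdiag γ k i j hi hj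
      rw [Matrix.add_apply, h2]
      by_cases hia : i = finL a
      · by_cases hjb : j = finL b
        · have hn : ¬ ((a : ℕ) = (b : ℕ)) := fun h => hab (Fin.ext h)
          subst hia hjb
          simp [ISR, finL, hE, hn]
        · simp only [hjb, if_false, ite_self]; linarith
      · simp only [hia, if_false]; linarith
    · rw [hsy j (by omega)]; simp
  · rw [hsx i (by omega)]; simp

/-- if the independent-set game with `γ = 1/(256·k·T³)` admits a uniform
`T`-sparse `(1/(4k²))`-CE supported only on `[n] × [n]` with welfare at least `1 + 3γ/(4k)`,
then the graph contains an independent set of size at least `k/(16T)`. -/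
theorem sparseCE_gives_indepSet_refined {n T : ℕ} (hT : 1 ≤ T)
    (A : Matrix (Fin n) (Fin n) ℝ)
    (hA01 : ∀ i j, A i j = 0 ∨ A i j = 1)
    (hAsym : ∀ i j, A i j = A j i)
    (hAdiag : ∀ i, A i i = 1)
    (k γ : ℝ) (hk : 1 ≤ k) (hγ : γ = 1 / (256 * k * (T : ℝ) ^ 3))
    (x y : Fin T → Fin (2 * n) → ℝ)
    (hx : ∀ t, x t ∈ simplex (2 * n)) (hy : ∀ t, y t ∈ simplex (2 * n))
    (hCE : IsSparseCE (ISR n A γ k) (ISC n A γ k) T x y (1 / (4 * k ^ 2)))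
    (hsupp : ∀ t (i : Fin (2 * n)), n ≤ (i : ℕ) → x t i = 0 ∧ y t i = 0)
    (hsw : (1 / (T : ℝ)) *
      ∑ t, x t ⬝ᵥ ((ISR n A γ k) + (ISC n A γ k)).mulVec (y t) ≥ 1 + 3 * γ / (4 * k)) :
    ∃ S : Finset (Fin n), IsIndepSet A S ∧ k / (16 * (T : ℝ)) ≤ (S.card : ℝ) := by
  have hTr : (1 : ℝ) ≤ T := by exact_mod_cast hT
  have hT0 : (0 : ℝ) < T := by linarith
  have hk0 : 0 < k := by linarith
  have hγ0 : 0 < γ := by rw [hγ]; positivity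
  have hT3 : (1 : ℝ) ≤ (T : ℝ) ^ 3 := one_le_pow₀ hTr
  have hγk : γ * k * (T : ℝ) ^ 3 = 1 / 256 := by rw [hγ]; field_simp
  have hγkT : γ * k * (T : ℝ) ≤ 1 / 256 := by
    rw [← hγk]
    have : (T : ℝ) ≤ (T : ℝ) ^ 3 := le_self_pow₀ hTr (by norm_num)
    exact mul_le_mul_of_nonneg_left this (by positivity)
  have hγs : γ ≤ 1 / 256 := by
    have h1 : γ * 1 ≤ γ * (k * T) := mul_le_mul_of_nonneg_left (by nlinarith) hγ0.le
    nlinarith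
  have hsx : ∀ t (i : Fin (2 * n)), n ≤ (i : ℕ) → x t i = 0 := fun t i h => (hsupp t i h).1
  have hsy : ∀ t (i : Fin (2 * n)), n ≤ (i : ℕ) → y t i = 0 := fun t i h => (hsupp t i h).2
  set ε : ℝ := 1 / (4 * k ^ 2) with hε
  have hε0 : 0 < ε := by positivity
  have hεk : ε * k ^ 2 = 1 / 4 := by rw [hε]; field_simp
  have hεk1 : ε * k ≤ 1 / 4 := by
    rw [← hεk]; exact mul_le_mul_of_nonneg_left (by nlinarith) hε0.le
  have hεs : ε ≤ 1 / 4 := by nlinarith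
  have hid : InPhi (id : Fin (2 * n) → Fin (2 * n)) ∨ n = 0 := by
    rcases Nat.eq_zero_or_pos n with h | h
    · exact Or.inr h
    · exact Or.inl (Or.inr ⟨⟨0, by omega⟩, fun i _ => rfl⟩)
  have key : ∀ a b : ℝ, (1 / (T : ℝ)) * a ≥ (1 / (T : ℝ)) * b - ε → b ≤ a + T * ε := by
    intro a b h
    have := mul_le_mul_of_nonneg_left h hT0.le
    have e1 : (T : ℝ) * (1 / (T : ℝ) * b - ε) = b - T * ε := by field_simp
    have e2 : (T : ℝ) * (1 / (T : ℝ) * a) = a := by field_simp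
    rw [e1, e2] at this; linarith
  -- the row player deviates to n + i
  have hrow : ∀ i : Fin n, k * ∑ t, y t (finL i) ≤ T * (1 + γ + 2 * ε) := by
    intro i
    have hn : 0 < n := by have := i.isLt; omega
    have hid' : InPhi (id : Fin (2 * n) → Fin (2 * n)) := hid.resolve_right (by omega)
    have hc : InPhi (fun _ : Fin (2 * n) => finR i) := by
      refine Or.inl ⟨finR i, ⟨2 * n - 1, by omega⟩, fun j => ⟨fun _ => rfl, fun h => ?_⟩⟩
      have h1 := j.isLt
      have h2 : 2 * n - 1 < (j : ℕ) := h
      omega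
    have h := key _ _ (hCE _ id hc hid').1
    simp only [dot_devApply] at h
    have e1 : ∀ t, ∑ j, x t j * (ISR n A γ k).mulVec (y t) (finR i) = k / 2 * y t (finL i) := by
      intro t
      rw [← Finset.sum_mul, (hx t).2, one_mul, ISR_mulVec_R A γ k _ (hsy t)]
    have e2 : ∑ t, x t ⬝ᵥ (ISR n A γ k).mulVec (y t) ≤ T * ((1 + γ) / 2) := by
      calc _ ≤ ∑ t : Fin T, (1 + γ) / 2 := by
            refine Finset.sum_le_sum fun t _ => ?_
            calc _ ≤ ∑ j, x t j * ((1 + γ) / 2) := by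
                  refine Finset.sum_le_sum fun j _ => ?_
                  by_cases hj : (j : ℕ) < n
                  · exact mul_le_mul_of_nonneg_left
                      (ISR_mulVec_le A hA01 hAdiag γ k hγ0.le _ (hy t) (hsy t) j hj) ((hx t).1 j)
                  · rw [hsx t j (by omega)]; simp
              _ = _ := by rw [← Finset.sum_mul, (hx t).2, one_mul]
        _ = _ := by simp
    simp only [e1, ← Finset.mul_sum] at h
    linarith
  -- the column player deviates from i to n + i
  have hcol : ∀ i : Fin n, k * ∑ t, x t (finL i) * y t (finL i)
      ≤ (1 + γ) * ∑ t, y t (finL i) + 2 * (T * ε) := by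
    intro i
    have hn : 0 < n := by have := i.isLt; omega
    have hid' : InPhi (id : Fin (2 * n) → Fin (2 * n)) := hid.resolve_right (by omega)
    set φ : Fin (2 * n) → Fin (2 * n) := fun j => if j = finL i then finR i else j with hφ
    have hc : InPhi φ := Or.inr ⟨finL i, fun j hj => by simp [hφ, hj]⟩
    have h := key _ _ (hCE id φ hid' hc).2
    simp only [Matrix.dotProduct_mulVec, dotProduct_comm _ (devApply _ _)] at h
    simp only [dot_devApply] at h
    have e : ∀ t, ∑ j, y t j * (Matrix.vecMul (x t) (ISC n A γ k)) (φ j)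
        = (Matrix.vecMul (x t) (ISC n A γ k)) ⬝ᵥ y t
          + (y t (finL i) * (k / 2 * x t (finL i))
            - y t (finL i) * (Matrix.vecMul (x t) (ISC n A γ k)) (finL i)) := by
      intro t
      rw [← ISC_vecMul_R A γ k _ (hsx t), dotProduct_comm, dotProduct, ← sub_eq_iff_eq_add',
        ← Finset.sum_sub_distrib, Finset.sum_eq_single (finL i)]
      · simp [hφ]
      · intro j _ hj
        simp [hφ, hj]
      · simp
    simp only [e, Finset.sum_add_distrib, Finset.sum_sub_distrib] at h
    have e2 : ∑ t, y t (finL i) * (Matrix.vecMul (x t) (ISC n A γ k)) (finL i)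
        ≤ (1 + γ) / 2 * ∑ t, y t (finL i) := by
      rw [Finset.mul_sum]
      refine Finset.sum_le_sum fun t _ => ?_
      rw [mul_comm]
      exact mul_le_mul_of_nonneg_right
        (ISC_vecMul_le A hA01 hAdiag γ k hγ0.le _ (hx t) (hsx t) (finL i) i.isLt) ((hy t).1 _)
    have e3 : ∑ t, y t (finL i) * (k / 2 * x t (finL i))
        = k / 2 * ∑ t, x t (finL i) * y t (finL i) := by
      rw [Finset.mul_sum]
      exact Finset.sum_congr rfl fun t _ => by ring
    rw [e3] at h
    linarith
  have hysum : ∀ i : Fin n, k * ∑ t, y t (finL i) ≤ T * (3 / 2 + 1 / 256) := by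
    intro i
    exact (hrow i).trans (mul_le_mul_of_nonneg_left (by linarith) hT0.le)
  have hy1 : ∀ t (i : Fin n), k * y t (finL i) ≤ T * (3 / 2 + 1 / 256) := by
    intro t i
    refine le_trans (mul_le_mul_of_nonneg_left ?_ hk0.le) (hysum i)
    exact Finset.single_le_sum (f := fun t => y t (finL i)) (fun t _ => (hy t).1 _)
      (Finset.mem_univ t)
  have hxy : ∀ t (i : Fin n), k ^ 2 * (x t (finL i) * y t (finL i)) ≤ 4 * T := by
    intro t i
    have h1 : x t (finL i) * y t (finL i) ≤ ∑ t, x t (finL i) * y t (finL i) :=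
      Finset.single_le_sum (f := fun t => x t (finL i) * y t (finL i))
        (fun t _ => mul_nonneg ((hx t).1 _) ((hy t).1 _)) (Finset.mem_univ t)
    have h2 := mul_le_mul_of_nonneg_left h1 hk0.le
    have h3 := mul_le_mul_of_nonneg_left (h2.trans (hcol i)) hk0.le
    have h4 := hysum i
    have h5 : (1 + γ) * (k * ∑ t, y t (finL i)) ≤ (1 + 1 / 256) * (T * (3 / 2 + 1 / 256)) :=
      mul_le_mul (by linarith) h4
        (mul_nonneg hk0.le (Finset.sum_nonneg fun t _ => (hy t).1 _)) (by norm_num)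
    have h6 : (T : ℝ) * (ε * k) ≤ T * (1 / 4) := mul_le_mul_of_nonneg_left hεk1 hT0.le
    nlinarith
  -- choose a round
  obtain ⟨t, ht⟩ : ∃ t, 1 + 3 * γ / (4 * k)
      ≤ x t ⬝ᵥ ((ISR n A γ k) + (ISC n A γ k)).mulVec (y t) := by
    by_contra! hcon
    have hne : (Finset.univ : Finset (Fin T)).Nonempty := ⟨⟨0, hT⟩, Finset.mem_univ _⟩
    have := Finset.sum_lt_sum_of_nonempty hne fun t _ => hcon t
    simp only [Finset.sum_const, Finset.card_univ, Fintype.card_fin, nsmul_eq_mul] at this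
    have h2 := mul_lt_mul_of_pos_left this (by positivity : 0 < 1 / (T : ℝ))
    rw [← mul_assoc, one_div_mul_cancel hT0.ne', one_mul] at h2
    linarith
  set δ := ∑ i, x t i * y t i with hδ
  have hδlow : 3 / (4 * k) ≤ δ := by
    have h := ht.trans (welfare_le A hA01 hAdiag γ k _ _ (hx t) (hy t) (hsx t) (hsy t))
    have h2 : γ * (3 / (4 * k)) ≤ γ * δ := by
      have : γ * (3 / (4 * k)) = 3 * γ / (4 * k) := by ring
      rw [this]; linarith
    exact le_of_mul_le_mul_left h2 hγ0
  have hδup : k * δ ≤ T * (3 / 2 + 1 / 256) := by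
    calc k * δ = ∑ i, x t i * (k * y t i) := by
          rw [hδ, Finset.mul_sum]; exact Finset.sum_congr rfl fun i _ => by ring
      _ ≤ ∑ i, x t i * (T * (3 / 2 + 1 / 256)) := by
          refine Finset.sum_le_sum fun i _ => ?_
          by_cases hi : (i : ℕ) < n
          · exact mul_le_mul_of_nonneg_left (hy1 t ⟨i, hi⟩) ((hx t).1 i)
          · rw [hsx t i (by omega)]; simp
      _ = _ := by rw [← Finset.sum_mul, (hx t).2, one_mul]
  classical
  refine ⟨Finset.univ.filter fun i : Fin n =>
    1 / (4 * k) ≤ x t (finL i) ∧ 1 / (4 * k) ≤ y t (finL i), ?_, ?_⟩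
  · intro a ha b hb hab
    rcases hA01 a b with h | h
    · exact h
    exfalso
    have hxa := (Finset.mem_filter.1 ha).2.1
    have hyb := (Finset.mem_filter.1 hb).2.2
    have hw := ht.trans (welfare_edge_le A hA01 hAdiag γ k _ _ (hx t) (hy t) (hsx t) (hsy t)
      a b hab h)
    have hp : 0 < 3 * γ / (4 * k) := by positivity
    have h1 : 1 / (4 * k) * (1 / (4 * k)) ≤ x t (finL a) * y t (finL b) :=
      mul_le_mul hxa hyb (by positivity) ((hx t).1 _)
    have h2 : 1 / (4 * k) * (1 / (4 * k)) ≤ γ * δ := by linarith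
    have h3 := mul_le_mul_of_nonneg_left h2 (by positivity : 0 ≤ k ^ 2)
    have h4 : k ^ 2 * (1 / (4 * k) * (1 / (4 * k))) = 1 / 16 := by field_simp; norm_num
    have h5 : γ * k * (k * δ) ≤ γ * k * (T * (3 / 2 + 1 / 256)) :=
      mul_le_mul_of_nonneg_left hδup (by positivity)
    nlinarith
  · set S := Finset.univ.filter fun i : Fin n =>
      1 / (4 * k) ≤ x t (finL i) ∧ 1 / (4 * k) ≤ y t (finL i) with hS
    have hB : δ ≤ ∑ i, (x t i * (1 / (4 * k)) + y t i * (1 / (4 * k))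
        + if i ∈ S.image finL then 4 * T / k ^ 2 else 0) := by
      refine Finset.sum_le_sum fun i _ => ?_
      have hx0 := (hx t).1 i
      have hy0 := (hy t).1 i
      have hq : 0 < 1 / (4 * k) := by positivity
      by_cases hi : i ∈ S.image finL
      · obtain ⟨j, _, rfl⟩ := Finset.mem_image.1 hi
        rw [if_pos hi]
        have : x t (finL j) * y t (finL j) ≤ 4 * T / k ^ 2 := by
          rw [le_div_iff₀ (by positivity)]; linarith [hxy t j]
        have := mul_nonneg hx0 hq.le
        have := mul_nonneg hy0 hq.le
        linarith
      · rw [if_neg hi, add_zero]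
        by_cases hn : (i : ℕ) < n
        · have hni : ¬ (1 / (4 * k) ≤ x t i ∧ 1 / (4 * k) ≤ y t i) := by
            intro h
            exact hi (Finset.mem_image.2 ⟨⟨i, hn⟩, Finset.mem_filter.2 ⟨Finset.mem_univ _, h⟩, rfl⟩)
          by_cases h1 : 1 / (4 * k) ≤ x t i
          · have h2 : y t i ≤ 1 / (4 * k) := by
              by_contra! h'; exact hni ⟨h1, h'.le⟩
            have := mul_le_mul_of_nonneg_left h2 hx0
            have := mul_nonneg hy0 hq.le
            linarith
          · have := mul_le_mul_of_nonneg_right (not_le.1 h1).le hy0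
            have := mul_nonneg hx0 hq.le
            linarith
        · rw [hsx t i (by omega), hsy t i (by omega)]; simp
    rw [Finset.sum_add_distrib, Finset.sum_add_distrib, ← Finset.sum_mul, ← Finset.sum_mul,
      (hx t).2, (hy t).2, Finset.sum_ite_mem, Finset.univ_inter, Finset.sum_const,
      nsmul_eq_mul] at hB
    have hc : ((S.image finL).card : ℝ) ≤ S.card := by exact_mod_cast Finset.card_image_le
    have h1 : ((S.image finL).card : ℝ) * (4 * T / k ^ 2) ≤ S.card * (4 * T / k ^ 2) :=
      mul_le_mul_of_nonneg_right hc (by positivity)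
    have h2 : 3 / (4 * k) ≤ 1 * (1 / (4 * k)) + 1 * (1 / (4 * k)) + S.card * (4 * T / k ^ 2) := by
      linarith
    have h3 : 1 / (4 * k) ≤ S.card * (4 * T / k ^ 2) := by
      have : 3 / (4 * k) = 3 * (1 / (4 * k)) := by ring
      linarith
    have h4 := mul_le_mul_of_nonneg_left h3 (by positivity : 0 ≤ 4 * k ^ 2)
    have h5 : 4 * k ^ 2 * (1 / (4 * k)) = k := by field_simp
    have h6 : 4 * k ^ 2 * (S.card * (4 * T / k ^ 2)) = S.card * (16 * T) := by field_simp; ring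
    rw [div_le_iff₀ (by positivity)]
    linarith
end
end

section
/- There exist absolute constants ε₀ > 0 and C₀ > 0 such that the following holds. Let ℓ be an even positive integer, n = binom(ℓ, ℓ/2), and S ⊆ [n] with |S| = ℓ, and let (R^S, C^S) be the associated low-precision game. For every integer T ≥ 1, every 0 ≤ ε ≤ ε₀, and every uniform T-sparse ε-CCE μ = (1/T) ∑_{t=1}^T x^{(t)} ⊗ y^{(t)} of (R^S, C^S), it holds that ‖(1/T) ∑_{t=1}^T x^{(t)} − u(S)‖₁ ≤ C₀·ε. -/
open Finset Matrix

noncomputable section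

/-- Row player's payoff matrix of the low-precision game associated with `S ⊆ [n]`
(`|S| = ℓ`, `n = binom(ℓ, ℓ/2)`) and a bijection `j ↦ S_j` onto the `(ℓ/2)`-subsets of `S`:
for `i ∉ S` the entry is `−1`; for `i ∈ S ∩ S_j` it is `1`; otherwise `0`. -/
def LPR {n : ℕ} (S : Finset (Fin n)) (Sj : Fin n → Finset (Fin n)) :
    Matrix (Fin n) (Fin n) ℝ := fun i j =>
  if i ∉ S then -1 else if i ∈ Sj j then 1 else 0

/-- Column player's payoff matrix of the low-precision game: for `i ∉ S` the entry is `1`;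
for `i ∈ S ∩ S_j` it is `0`; otherwise `1`. -/
def LPC {n : ℕ} (S : Finset (Fin n)) (Sj : Fin n → Finset (Fin n)) :
    Matrix (Fin n) (Fin n) ℝ := fun i j =>
  if i ∉ S then 1 else if i ∈ Sj j then 0 else 1

/-- `Sj` is a bijection from `[n]` onto the family of `(ℓ/2)`-element subsets of `S`. -/
def IsHalfSubsetEnum {n : ℕ} (ℓ : ℕ) (S : Finset (Fin n))
    (Sj : Fin n → Finset (Fin n)) : Prop :=
  (∀ j, Sj j ⊆ S) ∧ (∀ j, (Sj j).card = ℓ / 2) ∧ Function.Injective Sj ∧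
  (∀ B : Finset (Fin n), B ⊆ S → B.card = ℓ / 2 → ∃ j, Sj j = B)

lemma halfset_le {α : Type*} [DecidableEq α] (A : Finset α) (k : ℕ) (g : α → ℝ) (δ : ℝ)
    (h1 : k ≤ A.card) (h2 : A.card ≤ 2 * k) (hg : ∀ a ∈ A, 0 ≤ g a)
    (hL : ∀ L ⊆ A, L.card = k → ∑ a ∈ L, g a ≤ δ) : ∑ a ∈ A, g a ≤ 2 * δ := by
  obtain ⟨L, hLA, hLc⟩ := Finset.exists_subset_card_eq h1
  have hc : (A \ L).card ≤ k := by
    rw [Finset.card_sdiff_of_subset hLA]; omega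
  obtain ⟨M, hM1, hM2, hMc⟩ := Finset.exists_subsuperset_card_eq
    (Finset.sdiff_subset : A \ L ⊆ A) hc h1
  have e1 := hL L hLA hLc
  have e2 := hL M hM2 hMc
  have e3 : ∑ a ∈ A \ L, g a ≤ ∑ a ∈ M, g a :=
    Finset.sum_le_sum_of_subset_of_nonneg hM1 (fun i hi _ => hg i (hM2 hi))
  have e4 := Finset.sum_sdiff (f := g) hLA
  linarith

lemma halfset_abs {α : Type*} [DecidableEq α] (S : Finset α) (k : ℕ) (f : α → ℝ) (δ : ℝ)
    (hS : S.card = 2 * k)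
    (hL : ∀ L ⊆ S, L.card = k → |∑ a ∈ L, f a| ≤ δ) :
    ∑ a ∈ S, |f a| ≤ 4 * δ + |∑ a ∈ S, f a| := by
  have hc := Finset.card_filter_add_card_filter_not (s := S) (fun a => 0 ≤ f a)
  have hs := Finset.sum_filter_add_sum_filter_not S (fun a => 0 ≤ f a) f
  have ha := Finset.sum_filter_add_sum_filter_not S (fun a => 0 ≤ f a) (fun a => |f a|)
  have p1 : ∑ a ∈ S with 0 ≤ f a, |f a| = ∑ a ∈ S with 0 ≤ f a, f a :=
    Finset.sum_congr rfl (fun a h => abs_of_nonneg (Finset.mem_filter.1 h).2)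
  have p2 : ∑ a ∈ S with ¬ 0 ≤ f a, |f a| = - ∑ a ∈ S with ¬ 0 ≤ f a, f a := by
    rw [← Finset.sum_neg_distrib]
    exact Finset.sum_congr rfl
      (fun a h => abs_of_neg (not_le.1 (Finset.mem_filter.1 h).2))
  have b1 := le_abs_self (∑ a ∈ S, f a)
  have b2 := neg_le_abs (∑ a ∈ S, f a)
  by_cases hk : k ≤ (S.filter (fun a => 0 ≤ f a)).card
  · have := halfset_le (S.filter (fun a => 0 ≤ f a)) k f δ hk (by omega)
      (fun a h => (Finset.mem_filter.1 h).2)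
      (fun L h hc => (abs_le.1 (hL L (h.trans (Finset.filter_subset _ _)) hc)).2)
    linarith
  · have := halfset_le (S.filter (fun a => ¬ 0 ≤ f a)) k (fun a => - f a) δ
      (by omega) (by omega)
      (fun a h => by have := (Finset.mem_filter.1 h).2; linarith)
      (fun L h hc => by
        have := (abs_le.1 (hL L (h.trans (Finset.filter_subset _ _)) hc)).1
        rw [Finset.sum_neg_distrib]; linarith)
    rw [Finset.sum_neg_distrib] at this
    linarith

lemma LP_add {n : ℕ} (S : Finset (Fin n)) (Sj : Fin n → Finset (Fin n)) (x y : Fin n → ℝ)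
    (hy : ∑ j, y j = 1) :
    x ⬝ᵥ (LPR S Sj).mulVec y + x ⬝ᵥ (LPC S Sj).mulVec y = ∑ i ∈ S, x i := by
  rw [← dotProduct_add, ← Matrix.add_mulVec]
  have h : (LPR S Sj + LPC S Sj).mulVec y = fun i => if i ∈ S then 1 else 0 := by
    funext i
    have : ∀ j, (LPR S Sj + LPC S Sj) i j = if i ∈ S then 1 else 0 := by
      intro j
      simp only [Matrix.add_apply, LPR, LPC]
      split_ifs <;> norm_num
    simp only [Matrix.mulVec, dotProduct, this, ← Finset.mul_sum, hy, mul_one]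
  rw [h]
  simp [dotProduct]

lemma LP_unif {n : ℕ} (ℓ : ℕ) (hℓ : Even ℓ) (h0 : 0 < ℓ) (S : Finset (Fin n))
    (Sj : Fin n → Finset (Fin n)) (hS : S.card = ℓ) (hE : IsHalfSubsetEnum ℓ S Sj)
    (y : Fin n → ℝ) (hy : ∑ j, y j = 1) :
    unif S ⬝ᵥ (LPR S Sj).mulVec y = 1 / 2 := by
  rw [Matrix.dotProduct_mulVec]
  have h : Matrix.vecMul (unif S) (LPR S Sj) = fun _ => 1 / 2 := by
    funext j
    have : ∀ i, unif S i * LPR S Sj i j = if i ∈ Sj j then (ℓ : ℝ)⁻¹ else 0 := by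
      intro i
      have := @hE.1 j i
      simp only [unif, LPR, hS]
      by_cases h1 : i ∈ S <;> by_cases h2 : i ∈ Sj j <;> simp_all
    simp only [Matrix.vecMul, dotProduct, this]
    rw [Finset.sum_ite_mem, Finset.univ_inter, Finset.sum_const, hE.2.1 j]
    obtain ⟨k, rfl⟩ := hℓ
    have hk : (k + k) / 2 = k := by omega
    have : (k : ℝ) ≠ 0 := by
      have : k ≠ 0 := by omega
      exact_mod_cast this
    rw [hk]
    simp only [nsmul_eq_mul]
    push_cast
    field_simp
    norm_num
  rw [h]
  simp only [dotProduct, ← Finset.mul_sum, hy, mul_one]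

lemma LP_single {n : ℕ} (S : Finset (Fin n)) (Sj : Fin n → Finset (Fin n))
    (hE : ∀ j, Sj j ⊆ S) (x : Fin n → ℝ) (hx : ∑ j, x j = 1) (j : Fin n) :
    x ⬝ᵥ (LPC S Sj).mulVec (Pi.single j 1) = 1 - ∑ i ∈ Sj j, x i := by
  have h : (LPC S Sj).mulVec (Pi.single j 1) = fun i => 1 - if i ∈ Sj j then 1 else 0 := by
    funext i
    have := @hE j i
    rw [Matrix.mulVec_single_one]
    simp only [Matrix.col_apply, LPC]
    by_cases h1 : i ∈ S <;> by_cases h2 : i ∈ Sj j <;> simp_all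
  rw [h]
  simp [dotProduct, mul_sub, hx]

/-- there are constants `ε₀, C₀ > 0` such that in any low-precision game, the
average of the first player's marginals of any uniform `T`-sparse `ε`-CCE (`ε ≤ ε₀`) is
within `C₀·ε` of the uniform distribution over `S` in `ℓ₁`. -/
theorem lowPrecision_marginal_close_to_uniform :
    ∃ ε₀ > (0 : ℝ), ∃ C₀ > (0 : ℝ),
      ∀ (ℓ n : ℕ), Even ℓ → 0 < ℓ → n = ℓ.choose (ℓ / 2) →
      ∀ (S : Finset (Fin n)) (Sj : Fin n → Finset (Fin n)),
        S.card = ℓ → IsHalfSubsetEnum ℓ S Sj →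
      ∀ (T : ℕ), 1 ≤ T → ∀ ε : ℝ, 0 ≤ ε → ε ≤ ε₀ →
      ∀ x y : Fin T → Fin n → ℝ,
        (∀ t, x t ∈ simplex n) → (∀ t, y t ∈ simplex n) →
        IsSparseCCE (LPR S Sj) (LPC S Sj) T x y ε →
        ∑ i, |(1 / (T : ℝ)) * (∑ t, x t i) - unif S i| ≤ C₀ * ε := by
  refine ⟨1, one_pos, 12, by norm_num, ?_⟩
  intro ℓ n hℓ h0 _ S Sj hS hE T hT ε hε _ x y hx hy hC
  have hT0 : (T : ℝ) ≠ 0 := by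
    have : T ≠ 0 := by omega
    exact_mod_cast this
  set X : Fin n → ℝ := fun i => (1 / (T : ℝ)) * (∑ t, x t i) with hX
  have hXsum : ∀ A : Finset (Fin n), ∑ i ∈ A, X i = (1 / (T : ℝ)) * ∑ t, ∑ i ∈ A, x t i := by
    intro A
    simp only [hX]
    rw [← Finset.mul_sum, Finset.sum_comm]
  have hX0 : ∀ i, 0 ≤ X i := fun i =>
    mul_nonneg (by positivity) (Finset.sum_nonneg fun t _ => (hx t).1 i)
  have hX1 : ∑ i, X i = 1 := by
    rw [hXsum]
    simp [fun t => (hx t).2, hT0]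
  have hℓ0 : (ℓ : ℝ) ≠ 0 := by
    have : ℓ ≠ 0 := by omega
    exact_mod_cast this
  have hu : unif S ∈ simplex n := by
    constructor
    · intro i
      unfold unif
      split_ifs <;> positivity
    · simp [unif, hS, hℓ0]
  have hR := hC.1 _ hu
  simp only [fun t => LP_unif ℓ hℓ h0 S Sj hS hE (y t) (hy t).2] at hR
  have hc : (1 / (T : ℝ)) * ∑ _t : Fin T, (1 / 2 : ℝ) = 1 / 2 := by
    simp [hT0]
  rw [hc] at hR
  have hadd : (1 / (T : ℝ)) * ∑ t, x t ⬝ᵥ (LPR S Sj).mulVec (y t)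
      + (1 / (T : ℝ)) * ∑ t, x t ⬝ᵥ (LPC S Sj).mulVec (y t) = ∑ i ∈ S, X i := by
    rw [← mul_add, ← Finset.sum_add_distrib, hXsum]
    simp only [fun t => LP_add S Sj (x t) (y t) (hy t).2]
  have hcol : ∀ L ⊆ S, L.card = ℓ / 2 →
      3 / 2 - ∑ i ∈ S, X i - 2 * ε ≤ ∑ i ∈ L, X i := by
    intro L hL hLc
    obtain ⟨j, rfl⟩ := hE.2.2.2 L hL hLc
    have h := hC.2 (Pi.single j 1) ⟨fun i => by
      by_cases h : i = j
      · subst h; simp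
      · simp [h], by simp⟩
    simp only [fun t => LP_single S Sj hE.1 (x t) (hx t).2 j] at h
    have e : (1 / (T : ℝ)) * ∑ t, (1 - ∑ i ∈ Sj j, x t i) = 1 - ∑ i ∈ Sj j, X i := by
      rw [Finset.sum_sub_distrib, mul_sub, hXsum]
      simp [hT0]
    rw [e] at h
    linarith
  obtain ⟨k, hk⟩ := hℓ
  have hk2 : ℓ / 2 = k := by omega
  rw [hk2] at hcol
  have hout := Finset.sum_add_sum_compl S X
  have hout0 : 0 ≤ ∑ i ∈ Sᶜ, X i := Finset.sum_nonneg fun i _ => hX0 i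
  rw [hX1] at hout
  have hcompl : ∀ L ⊆ S, L.card = k →
      3 / 2 - ∑ i ∈ S, X i - 2 * ε ≤ ∑ i ∈ S, X i - ∑ i ∈ L, X i := by
    intro L hL hLc
    have := hcol (S \ L) Finset.sdiff_subset (by
      rw [Finset.card_sdiff_of_subset hL]; omega)
    have e := Finset.sum_sdiff (f := X) hL
    linarith
  obtain ⟨L0, hL0, hL0c⟩ := Finset.exists_subset_card_eq (s := S) (n := k) (by omega)
  have q1 := hcol L0 hL0 hL0c
  have q2 := hcompl L0 hL0 hL0c
  have hkk : (ℓ : ℝ) = 2 * k := by rw [hk]; push_cast; ring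
  have hk0 : (k : ℝ) ≠ 0 := by
    intro h; apply hℓ0; rw [hkk, h]; ring
  have hsub : ∀ A : Finset (Fin n), ∑ i ∈ A, (X i - (ℓ : ℝ)⁻¹)
      = ∑ i ∈ A, X i - A.card * (ℓ : ℝ)⁻¹ := by
    intro A
    simp [Finset.sum_sub_distrib]
  have main := halfset_abs S k (fun i => X i - (ℓ : ℝ)⁻¹) (2 * ε) (by omega) (by
    intro L hL hLc
    have a1 := hcol L hL hLc
    have a2 := hcompl L hL hLc
    have : (k : ℝ) * (ℓ : ℝ)⁻¹ = 1 / 2 := by rw [hkk]; field_simp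
    rw [hsub, hLc, this, abs_le]
    constructor <;> linarith)
  rw [hsub S, hS, mul_inv_cancel₀ hℓ0, abs_of_nonpos (by linarith)] at main
  have hsplit := Finset.sum_add_sum_compl S (fun i => |X i - unif S i|)
  have s1 : ∑ i ∈ S, |X i - unif S i| = ∑ i ∈ S, |X i - (ℓ : ℝ)⁻¹| :=
    Finset.sum_congr rfl fun i hi => by simp [unif, hi, hS]
  have s2 : ∑ i ∈ Sᶜ, |X i - unif S i| = ∑ i ∈ Sᶜ, X i :=
    Finset.sum_congr rfl fun i hi => by
      have : i ∉ S := Finset.mem_compl.1 hi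
      simp [unif, this, abs_of_nonneg (hX0 i)]
  rw [← hsplit, s1, s2]
  linarith
end
end

section
/- Let ℓ be an even positive integer, n = binom(ℓ, ℓ/2), S ⊆ [n] with |S| = ℓ, and let (R^S, C^S) be the associated low-precision game. Then ⟨u(S), R^S y⟩ ≥ 1/2 for every y ∈ Δⁿ, and ⟨x, C^S u([n])⟩ ≥ 1/2 for every x ∈ Δⁿ, where u(S) ∈ Δⁿ is the uniform distribution over S and u([n]) ∈ Δⁿ is the uniform distribution over all n columns. -/
open Finset Matrix

noncomputable section

/-- in the low-precision game, `u(S)` guarantees Player x a utility of at least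
`1/2` against any mixed strategy, and `u([n])` guarantees Player y a utility of at least `1/2`
against any mixed strategy. -/
theorem lowPrecision_security_strategies {ℓ n : ℕ}
    (hℓeven : Even ℓ) (hℓpos : 0 < ℓ) (hn : n = ℓ.choose (ℓ / 2))
    (S : Finset (Fin n)) (Sj : Fin n → Finset (Fin n))
    (hScard : S.card = ℓ) (hSj : IsHalfSubsetEnum ℓ S Sj) :
    (∀ y ∈ simplex n, unif S ⬝ᵥ (LPR S Sj).mulVec y ≥ 1 / 2) ∧
    (∀ x ∈ simplex n, x ⬝ᵥ (LPC S Sj).mulVec (unif Finset.univ) ≥ 1 / 2) := by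
  obtain ⟨hsub, hcard, hinj, hsurj⟩ := hSj
  have hℓ2 : ℓ / 2 + ℓ / 2 = ℓ := by
    obtain ⟨k, hk⟩ := hℓeven
    omega
  have hℓ2R : ((ℓ / 2 : ℕ) : ℝ) + ((ℓ / 2 : ℕ) : ℝ) = (ℓ : ℝ) := by exact_mod_cast hℓ2
  have hℓR : (0 : ℝ) < ℓ := by exact_mod_cast hℓpos
  have hnpos : 0 < n := by
    rw [hn]
    exact Nat.choose_pos (Nat.div_le_self _ _)
  have hnR : (0 : ℝ) < n := by exact_mod_cast hnpos
  constructor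
  · intro y hy
    obtain ⟨hy0, hy1⟩ := hy
    rw [Matrix.dotProduct_mulVec]
    have key : ∀ j, (unif S ᵥ* LPR S Sj) j = 1 / 2 := by
      intro j
      have h1 : (unif S ᵥ* LPR S Sj) j = ∑ i, if i ∈ Sj j then (ℓ : ℝ)⁻¹ else 0 := by
        simp only [Matrix.vecMul, dotProduct]
        refine Finset.sum_congr rfl fun i _ => ?_
        unfold unif LPR
        by_cases hi : i ∈ S
        · simp [hi, hScard]
        · have : i ∉ Sj j := fun h => hi (hsub j h)
          simp [hi, this]
      rw [h1, Finset.sum_ite_mem, Finset.univ_inter, Finset.sum_const, hcard, nsmul_eq_mul]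
      field_simp
      linarith
    simp only [dotProduct, key]
    rw [← Finset.mul_sum, hy1]
    norm_num
  · intro x hx
    obtain ⟨hx0, hx1⟩ := hx
    have key : ∀ i, 1 / 2 ≤ (LPC S Sj).mulVec (unif Finset.univ) i := by
      intro i
      have h1 : (LPC S Sj).mulVec (unif Finset.univ) i =
          ((Finset.univ.filter fun j => i ∉ Sj j).card : ℝ) * (n : ℝ)⁻¹ := by
        simp only [Matrix.mulVec, dotProduct]
        rw [← nsmul_eq_mul, ← Finset.sum_const, Finset.sum_filter]
        refine Finset.sum_congr rfl fun j _ => ?_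
        unfold unif LPC
        by_cases hi : i ∈ S
        · by_cases hj : i ∈ Sj j <;> simp [hi, hj]
        · have : i ∉ Sj j := fun h => hi (hsub j h)
          simp [hi, this]
      have hc : ∀ j, ∃ k, Sj k = S \ Sj j := fun j =>
        hsurj _ Finset.sdiff_subset (by
          rw [Finset.card_sdiff_of_subset (hsub j), hcard, hScard]
          omega)
      choose f hf using hc
      have h2 : (Finset.univ.filter fun j => i ∈ Sj j).card ≤
          (Finset.univ.filter fun j => i ∉ Sj j).card := by
        refine Finset.card_le_card_of_injOn f ?_ ?_
        · intro j hj
          simp only [Finset.coe_filter, Finset.mem_univ, true_and, Set.mem_setOf_eq] at hj ⊢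
          rw [hf]
          simp [hj]
        · intro a _ b _ hab
          apply hinj
          have h3 : S \ Sj a = S \ Sj b := by rw [← hf, ← hf, hab]
          rw [← Finset.sdiff_sdiff_eq_self (hsub a), h3, Finset.sdiff_sdiff_eq_self (hsub b)]
      have h4 : (Finset.univ.filter fun j => i ∈ Sj j).card +
          (Finset.univ.filter fun j => i ∉ Sj j).card = n := by
        rw [Finset.card_filter_add_card_filter_not]
        simp
      have h5 : (n : ℝ) ≤ 2 * ((Finset.univ.filter fun j => i ∉ Sj j).card : ℝ) := by
        exact_mod_cast (by omega : n ≤ 2 * (Finset.univ.filter fun j => i ∉ Sj j).card)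
      rw [h1, ← div_eq_mul_inv, le_div_iff₀ hnR]
      linarith
    calc (1 / 2 : ℝ) = ∑ i, x i * (1 / 2) := by rw [← Finset.sum_mul, hx1]; norm_num
      _ ≤ x ⬝ᵥ (LPC S Sj).mulVec (unif Finset.univ) :=
        Finset.sum_le_sum fun i _ => mul_le_mul_of_nonneg_left (key i) (hx0 i)
end
end

section
/- There exist absolute constants ε₀ > 0 and C₀ > 0 such that the following holds. Let ℓ be an even positive integer, n = binom(ℓ, ℓ/2), and let S, S' ⊆ [n] both have size ℓ, with associated low-precision games (R^S, C^S) and (R^{S'}, C^{S'}). If 0 ≤ ε ≤ ε₀ and ‖u(S) − u(S')‖₁ > 2C₀·ε, then for all integers T, T' ≥ 1, any uniform T-sparse ε-CCE μ of (R^S, C^S) and any uniform T'-sparse ε-CCE μ' of (R^{S'}, C^{S'}) satisfy μ ≠ μ' (as distributions on [n]×[n]). -/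
open Finset Matrix

noncomputable section

theorem aux_pos {n k : ℕ} (S P : Finset (Fin n)) (hS : S.card = 2 * k) (hP : P ⊆ S)
    (hk : k ≤ P.card) (d : Fin n → ℝ) (c : ℝ) (hd : ∀ i ∈ P, 0 ≤ d i)
    (h : ∀ B ⊆ S, B.card = k → ∑ i ∈ B, d i ≤ c) : ∑ i ∈ P, d i ≤ 2 * c := by
  obtain ⟨B, hBP, hB⟩ := Finset.exists_subset_card_eq hk
  have h1 : (P \ B).card ≤ k := by
    have := Finset.card_sdiff_add_card_eq_card hBP
    have := Finset.card_le_card hP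
    omega
  obtain ⟨B', h2, h3, hB'⟩ := Finset.exists_subsuperset_card_eq (sdiff_subset : P \ B ⊆ P) h1 hk
  have e := Finset.sum_sdiff (f := d) hBP
  have e1 := h B (hBP.trans hP) hB
  have e2 := h B' (h3.trans hP) hB'
  have e3 : ∑ i ∈ P \ B, d i ≤ ∑ i ∈ B', d i :=
    Finset.sum_le_sum_of_subset_of_nonneg h2 (fun i hi _ => hd i (h3 hi))
  linarith

theorem aux_abs {n k : ℕ} (S : Finset (Fin n)) (hS : S.card = 2 * k)
    (d : Fin n → ℝ) (c : ℝ)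
    (h : ∀ B ⊆ S, B.card = k → |∑ i ∈ B, d i| ≤ c) : ∑ i ∈ S, |d i| ≤ 6 * c := by
  obtain ⟨B, hBP, hB⟩ := Finset.exists_subset_card_eq (show k ≤ S.card by omega)
  have e := Finset.sum_sdiff (f := d) hBP
  have hB2 : (S \ B).card = k := by
    have := Finset.card_sdiff_add_card_eq_card hBP
    omega
  have e1 := abs_le.1 (h B hBP hB)
  have e2 := abs_le.1 (h (S \ B) sdiff_subset hB2)
  have hc := Finset.card_filter_add_card_filter_not (s := S) (fun i => 0 ≤ d i)
  have hs := Finset.sum_filter_add_sum_filter_not S (fun i => 0 ≤ d i) d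
  have ha := Finset.sum_filter_add_sum_filter_not S (fun i => 0 ≤ d i) (fun i => |d i|)
  have p1 : ∑ i ∈ S with 0 ≤ d i, |d i| = ∑ i ∈ S with 0 ≤ d i, d i :=
    Finset.sum_congr rfl (fun i hi => abs_of_nonneg (Finset.mem_filter.1 hi).2)
  have p2 : ∑ i ∈ S with ¬ 0 ≤ d i, |d i| = - ∑ i ∈ S with ¬ 0 ≤ d i, d i := by
    rw [← Finset.sum_neg_distrib]
    exact Finset.sum_congr rfl
      (fun i hi => abs_of_neg (not_le.1 (Finset.mem_filter.1 hi).2))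
  by_cases hk : k ≤ (S.filter (fun i => 0 ≤ d i)).card
  · have := aux_pos S _ hS (filter_subset _ S) hk d c (fun i hi => (Finset.mem_filter.1 hi).2)
      (fun B h1 h2 => (abs_le.1 (h B h1 h2)).2)
    linarith
  · have := aux_pos S (S.filter (fun i => ¬ 0 ≤ d i)) hS (filter_subset _ S) (by omega)
      (fun i => - d i) c
      (fun i hi => by have := not_le.1 (Finset.mem_filter.1 hi).2; linarith)
      (fun B h1 h2 => by rw [Finset.sum_neg_distrib]; linarith [(abs_le.1 (h B h1 h2)).1])
    rw [Finset.sum_neg_distrib] at this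
    linarith

theorem aux_avg {T : ℕ} (hT : 1 ≤ T) (c : ℝ) : (1 / (T : ℝ)) * ∑ _t : Fin T, c = c := by
  have : (T : ℝ) ≠ 0 := by positivity
  simp; field_simp

theorem aux_marg {n k : ℕ} (hk : 0 < k) (S : Finset (Fin n)) (Sj : Fin n → Finset (Fin n))
    (hS : S.card = 2 * k) (hE : IsHalfSubsetEnum (2 * k) S Sj) (ε : ℝ) (T : ℕ) (hT : 1 ≤ T)
    (x y : Fin T → Fin n → ℝ) (hx : ∀ t, x t ∈ simplex n) (hy : ∀ t, y t ∈ simplex n)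
    (h : IsSparseCCE (LPR S Sj) (LPC S Sj) T x y ε) :
    ∑ i, |(1 / (T : ℝ)) * ∑ t, x t i - unif S i| ≤ 14 * ε := by
  obtain ⟨hsub, hcard, -, hsurj⟩ := hE
  have hk2 : 2 * k / 2 = k := by omega
  rw [hk2] at hcard hsurj
  obtain ⟨hR, hC⟩ := h
  have hkR : (0 : ℝ) < k := by exact_mod_cast hk
  -- uniform deviation
  have hu : unif S ∈ simplex n := by
    constructor
    · intro i; unfold unif; split_ifs <;> positivity
    · simp [unif, hS]; field_simp
  have hdevR : ∀ t, unif S ⬝ᵥ (LPR S Sj).mulVec (y t) = 1 / 2 := by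
    intro t
    rw [Matrix.dotProduct_mulVec]
    have : Matrix.vecMul (unif S) (LPR S Sj) = fun _ => 1 / 2 := by
      funext j
      have : ∀ i, unif S i * LPR S Sj i j = if i ∈ Sj j then ((2 * k : ℝ))⁻¹ else 0 := by
        intro i
        have := @hsub j i
        unfold unif LPR
        by_cases h1 : i ∈ S <;> by_cases h2 : i ∈ Sj j <;> simp_all
      simp only [Matrix.vecMul, dotProduct, this]
      simp [hcard]; field_simp
    rw [this]
    simp [dotProduct, ← Finset.mul_sum, (hy t).2]
  have hdevC : ∀ t j, x t ⬝ᵥ (LPC S Sj).mulVec (Pi.single j 1) = 1 - ∑ i ∈ Sj j, x t i := by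
    intro t j
    rw [Matrix.mulVec_single_one, ← (hx t).2, ← Finset.sum_filter_add_sum_filter_not univ (· ∈ Sj j) (x t)]
    have : ∀ i, x t i * LPC S Sj i j = if i ∉ Sj j then x t i else 0 := by
      intro i
      have := @hsub j i
      unfold LPC
      by_cases h1 : i ∈ S <;> by_cases h2 : i ∈ Sj j <;> simp_all
    simp only [dotProduct, Matrix.col_apply, this]
    rw [← Finset.sum_filter]
    simp
  have hsum : ∀ t, x t ⬝ᵥ (LPR S Sj).mulVec (y t) + x t ⬝ᵥ (LPC S Sj).mulVec (y t)
      = ∑ i ∈ S, x t i := by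
    intro t
    rw [← dotProduct_add, ← Matrix.add_mulVec]
    have : (LPR S Sj + LPC S Sj).mulVec (y t) = fun i => if i ∈ S then 1 else 0 := by
      funext i
      have : ∀ j, (LPR S Sj + LPC S Sj) i j = if i ∈ S then 1 else 0 := by
        intro j
        have := @hsub j i
        simp only [Matrix.add_apply, LPR, LPC]
        by_cases h1 : i ∈ S <;> by_cases h2 : i ∈ Sj j <;> simp_all
      simp only [Matrix.mulVec, dotProduct, this, ← Finset.mul_sum, (hy t).2, mul_one]
    rw [this]
    simp [dotProduct]
  set m : Fin n → ℝ := fun i => (1 / (T : ℝ)) * ∑ t, x t i with hm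
  have hmB : ∀ B : Finset (Fin n), ∑ i ∈ B, m i = (1 / (T : ℝ)) * ∑ t, ∑ i ∈ B, x t i := by
    intro B
    rw [Finset.sum_comm, Finset.mul_sum]
  have hm0 : ∀ i, 0 ≤ m i := fun i =>
    mul_nonneg (by positivity) (Finset.sum_nonneg fun t _ => (hx t).1 i)
  have hm1 : ∑ i, m i = 1 := by
    rw [hmB]; simp only [(hx _).2]; exact aux_avg hT 1
  have hV : (1 / (T : ℝ)) * ∑ t, x t ⬝ᵥ (LPR S Sj).mulVec (y t)
      + (1 / (T : ℝ)) * ∑ t, x t ⬝ᵥ (LPC S Sj).mulVec (y t) = ∑ i ∈ S, m i := by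
    rw [hmB, ← mul_add, ← Finset.sum_add_distrib]; simp only [hsum]
  have hVR := hR _ hu
  simp only [hdevR] at hVR
  rw [aux_avg hT] at hVR
  have key : ∀ B ⊆ S, B.card = k → ∑ i ∈ B, m i ≥ 3 / 2 - 2 * ε - ∑ i ∈ S, m i := by
    intro B hB hBk
    obtain ⟨j, rfl⟩ := hsurj B hB hBk
    have hj : (Pi.single j 1 : Fin n → ℝ) ∈ simplex n := by
      constructor
      · intro i; by_cases hij : i = j
        · subst hij; simp
        · simp [hij]
      · simp
    have hVC := hC _ hj
    simp only [hdevC] at hVC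
    rw [Finset.sum_sub_distrib, mul_sub, aux_avg hT, ← hmB] at hVC
    linarith
  have hcomp : ∀ B ⊆ S, B.card = k → ∑ i ∈ B, m i ≤ 2 * (∑ i ∈ S, m i) + 2 * ε - 3 / 2 := by
    intro B hB hBk
    have e := Finset.sum_sdiff (f := m) hB
    have := key (S \ B) sdiff_subset (by
      have := Finset.card_sdiff_add_card_eq_card hB
      omega)
    linarith
  have hq : ∑ i ∈ S, m i + ∑ i ∈ univ \ S, m i = 1 := by
    rw [add_comm, Finset.sum_sdiff (subset_univ S), hm1]
  have hp : 0 ≤ ∑ i ∈ univ \ S, m i := Finset.sum_nonneg fun i _ => hm0 i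
  obtain ⟨B₀, hB₀, hB₀k⟩ := Finset.exists_subset_card_eq (show k ≤ S.card by omega)
  have k1 := key B₀ hB₀ hB₀k
  have k2 := hcomp B₀ hB₀ hB₀k
  have hA := aux_abs S hS (fun i => m i - unif S i) (2 * ε) (by
    intro B hB hBk
    have : ∑ i ∈ B, unif S i = 1 / 2 := by
      rw [Finset.sum_congr rfl (g := fun _ => ((2 * k : ℝ))⁻¹)
        (fun i hi => by simp [unif, hB hi, hS])]
      simp [hBk]; field_simp
    rw [Finset.sum_sub_distrib, this, abs_le]
    have := key B hB hBk
    have := hcomp B hB hBk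
    constructor <;> linarith)
  rw [← Finset.sum_sdiff (subset_univ S)]
  have : ∑ i ∈ univ \ S, |m i - unif S i| = ∑ i ∈ univ \ S, m i :=
    Finset.sum_congr rfl (fun i hi => by
      have : i ∉ S := (Finset.mem_sdiff.1 hi).2
      simp [unif, this, abs_of_nonneg (hm0 i)])
  rw [this]
  linarith

/-- there are constants `ε₀, C₀ > 0` such that for two low-precision games
indexed by `S, S'` with `‖u(S) − u(S')‖₁ > 2C₀·ε` and `ε ≤ ε₀`, no uniform `T`-sparse `ε`-CCE
of the first coincides (as a distribution on `[n] × [n]`) with a uniform `T'`-sparse `ε`-CCE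
of the second. -/
theorem lowPrecision_CCEs_distinct :
    ∃ ε₀ > (0 : ℝ), ∃ C₀ > (0 : ℝ),
      ∀ (ℓ n : ℕ), Even ℓ → 0 < ℓ → n = ℓ.choose (ℓ / 2) →
      ∀ (S S' : Finset (Fin n)) (Sj Sj' : Fin n → Finset (Fin n)),
        S.card = ℓ → S'.card = ℓ →
        IsHalfSubsetEnum ℓ S Sj → IsHalfSubsetEnum ℓ S' Sj' →
      ∀ ε : ℝ, 0 ≤ ε → ε ≤ ε₀ →
        (∑ i, |unif S i - unif S' i|) > 2 * C₀ * ε →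
      ∀ (T T' : ℕ), 1 ≤ T → 1 ≤ T' →
      ∀ (x y : Fin T → Fin n → ℝ) (x' y' : Fin T' → Fin n → ℝ),
        (∀ t, x t ∈ simplex n) → (∀ t, y t ∈ simplex n) →
        (∀ t, x' t ∈ simplex n) → (∀ t, y' t ∈ simplex n) →
        IsSparseCCE (LPR S Sj) (LPC S Sj) T x y ε →
        IsSparseCCE (LPR S' Sj') (LPC S' Sj') T' x' y' ε →
        (fun (i j : Fin n) => (1 / (T : ℝ)) * ∑ t, x t i * y t j) ≠
          (fun (i j : Fin n) => (1 / (T' : ℝ)) * ∑ t, x' t i * y' t j) := by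
  refine ⟨1, one_pos, 14, by norm_num, ?_⟩
  intro ℓ n hev hl _ S S' Sj Sj' hS hS' hE hE' ε _ _ hgt T T' hT hT' x y x' y' hx hy hx' hy' h h' heq
  obtain ⟨k, rfl⟩ := hev.two_dvd
  have hk : 0 < k := by omega
  have a := aux_marg hk S Sj hS hE ε T hT x y hx hy h
  have b := aux_marg hk S' Sj' hS' hE' ε T' hT' x' y' hx' hy' h'
  have hmm : ∀ i, (1 / (T : ℝ)) * ∑ t, x t i = (1 / (T' : ℝ)) * ∑ t, x' t i := by
    intro i
    have := congrArg (fun f : Fin n → Fin n → ℝ => ∑ j, f i j) heq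
    simp only [← Finset.mul_sum] at this
    rw [Finset.sum_comm, Finset.sum_comm (s := univ (α := Fin n))] at this
    simpa only [← Finset.mul_sum, (hy _).2, (hy' _).2, mul_one] using this
  simp only [hmm] at a
  have : ∑ i, |unif S i - unif S' i| ≤
      ∑ i, |(1 / (T' : ℝ)) * ∑ t, x' t i - unif S i|
      + ∑ i, |(1 / (T' : ℝ)) * ∑ t, x' t i - unif S' i| := by
    rw [← Finset.sum_add_distrib]
    refine Finset.sum_le_sum fun i _ => ?_
    rw [abs_sub_comm ((1 / (T' : ℝ)) * ∑ t, x' t i) (unif S i)]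
    exact abs_sub_le _ _ _
  linarith
end
end

section
/- Let m ≥ 2 and let μ = (1/T) ∑_{t=1}^T x^{(t)} ⊗ y^{(t)} be a uniform T-sparse ε-CCE of the m×m generalized matching pennies game (I_m, −I_m). Then ‖(1/T) ∑_{t=1}^T x^{(t)} − u‖₁ ≤ 2m²ε, where u ∈ Δᵐ is the uniform distribution over [m]. -/
open Finset Matrix

noncomputable section

/-- in any uniform `T`-sparse `ε`-CCE of the generalized matching pennies game
`(I_m, −I_m)`, the average marginal of Player x is within `2m²ε` of uniform in `ℓ₁`. -/
theorem matchingPennies_CCE_marginal {m T : ℕ} (hm : 2 ≤ m) (hT : 0 < T)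
    (ε : ℝ)
    (x y : Fin T → Fin m → ℝ)
    (hx : ∀ t, x t ∈ simplex m) (hy : ∀ t, y t ∈ simplex m)
    (hCCE : IsSparseCCE (1 : Matrix (Fin m) (Fin m) ℝ)
      (-(1 : Matrix (Fin m) (Fin m) ℝ)) T x y ε) :
    ∑ i, |(1 / (T : ℝ)) * (∑ t, x t i) - unif (Finset.univ : Finset (Fin m)) i| ≤
      2 * (m : ℝ) ^ 2 * ε := by
  have hm0 : (0 : ℝ) < m := by
    have : 0 < m := by omega
    exact_mod_cast this
  have hm2 : (2 : ℝ) ≤ m := by exact_mod_cast hm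
  have hT0 : (T : ℝ) ≠ 0 := by
    have : T ≠ 0 := by omega
    exact_mod_cast this
  obtain ⟨h1, h2⟩ := hCCE
  have hu : (fun _ : Fin m => (m : ℝ)⁻¹) ∈ simplex m := by
    refine ⟨fun i => by positivity, ?_⟩
    simp [hm0.ne']
  have hA := h1 _ hu
  have hyu : ∀ t, (fun _ : Fin m => (m : ℝ)⁻¹) ⬝ᵥ (1 : Matrix (Fin m) (Fin m) ℝ).mulVec (y t)
      = (m : ℝ)⁻¹ := by
    intro t
    rw [Matrix.one_mulVec]
    simp only [dotProduct]
    rw [← Finset.mul_sum, (hy t).2, mul_one]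
  simp only [hyu] at hA
  simp only [Matrix.one_mulVec] at hA
  have hc : (1 / (T : ℝ)) * ∑ _t : Fin T, (m : ℝ)⁻¹ = (m : ℝ)⁻¹ := by
    simp only [Finset.sum_const, Finset.card_univ, Fintype.card_fin, nsmul_eq_mul]
    field_simp
  rw [hc] at hA
  have hB : ∀ j, (1 / (T : ℝ)) * (∑ t, x t j) - (m : ℝ)⁻¹ ≥ -(2 * ε) := by
    intro j
    have hj : (Pi.single j 1 : Fin m → ℝ) ∈ simplex m := by
      refine ⟨fun i => ?_, by simp⟩
      by_cases h : i = j
      · subst h; simp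
      · simp [h]
    have := h2 _ hj
    simp only [Matrix.neg_mulVec, Matrix.one_mulVec, dotProduct_neg, dotProduct_single, mul_one,
      Finset.sum_neg_distrib, mul_neg] at this
    linarith
  have hsum : ∑ j, ((1 / (T : ℝ)) * (∑ t, x t j) - (m : ℝ)⁻¹) = 0 := by
    rw [Finset.sum_sub_distrib, ← Finset.mul_sum, Finset.sum_comm]
    simp only [fun t => (hx t).2]
    simp [hm0.ne', hT0]
  have hu' : ∀ i, unif (Finset.univ : Finset (Fin m)) i = (m : ℝ)⁻¹ := by
    intro i; simp [unif]
  simp only [hu']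
  have hε : 0 ≤ ε := by
    have := Finset.sum_le_sum (fun j (_ : j ∈ (Finset.univ : Finset (Fin m))) => hB j)
    rw [hsum] at this
    simp only [Finset.sum_const, Finset.card_univ, Fintype.card_fin, nsmul_eq_mul] at this
    by_contra h
    push Not at h
    nlinarith
  calc _ ≤ ∑ j, (((1 / (T : ℝ)) * (∑ t, x t j) - (m : ℝ)⁻¹) + 4 * ε) := by
        refine Finset.sum_le_sum fun j _ => ?_
        have := hB j
        rw [abs_le]
        constructor <;> linarith
    _ = m * (4 * ε) := by
        rw [Finset.sum_add_distrib, hsum]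
        simp
    _ ≤ _ := by nlinarith [mul_nonneg (mul_nonneg hm0.le hε) (sub_nonneg.2 hm2)]
end
end

section
/- Let m ≥ 2 and ε ≥ 0, and let (x, y) ∈ Δᵐ × Δᵐ be an ε-Nash equilibrium of the m×m generalized matching pennies game (I_m, −I_m). Then |x_i − 1/m| ≤ 2εm for every i ∈ [m], and consequently ‖x − u‖₁ ≤ 2εm², where u ∈ Δᵐ is the uniform distribution over [m]. -/
open Finset Matrix

noncomputable section

/-- in any `ε`-Nash equilibrium `(x, y)` of the generalized matching pennies
game `(I_m, −I_m)` (`m ≥ 2`, `ε ≥ 0`), every coordinate of `x` is within `2εm` of `1/m`, and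
consequently `‖x − u‖₁ ≤ 2εm²`. -/
theorem matchingPennies_nash_marginal {m : ℕ} (hm : 2 ≤ m)
    (ε : ℝ) (hε : 0 ≤ ε)
    (x y : Fin m → ℝ) (hx : x ∈ simplex m) (hy : y ∈ simplex m)
    (hNE : IsNash (1 : Matrix (Fin m) (Fin m) ℝ)
      (-(1 : Matrix (Fin m) (Fin m) ℝ)) x y ε) :
    (∀ i, |x i - 1 / (m : ℝ)| ≤ 2 * ε * (m : ℝ)) ∧
    ∑ i, |x i - unif (Finset.univ : Finset (Fin m)) i| ≤ 2 * ε * (m : ℝ) ^ 2 := by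
  obtain ⟨hx0, hx1⟩ := hx
  obtain ⟨hy0, hy1⟩ := hy
  obtain ⟨h1, h2⟩ := hNE
  have hm0 : (0 : ℝ) < m := by
    have : 0 < m := by omega
    exact_mod_cast this
  have hm1 : (1 : ℝ) ≤ m := by
    have : 1 ≤ m := by omega
    exact_mod_cast this
  have hu := h1 (fun _ => 1 / (m : ℝ)) (by
    refine ⟨fun i => by positivity, ?_⟩
    simp [hm0.ne'])
  have hv : x ⬝ᵥ y ≥ 1 / (m : ℝ) - ε := by
    simp only [Matrix.one_mulVec] at hu
    have : (fun _ => 1 / (m : ℝ)) ⬝ᵥ y = 1 / (m : ℝ) := by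
      simp only [dotProduct]
      rw [← Finset.mul_sum, hy1, mul_one]
    rwa [this] at hu
  have hz : ∀ j, 0 ≤ x j - 1 / (m : ℝ) + 2 * ε := by
    intro j
    have h := h2 (Pi.single j 1) (by
      refine ⟨fun i => ?_, by simp⟩
      by_cases hij : i = j
      · subst hij; simp
      · simp [hij])
    simp only [Matrix.neg_mulVec, Matrix.one_mulVec, dotProduct_neg, dotProduct_single,
      mul_one] at h
    linarith
  have hs : ∑ j, (x j - 1 / (m : ℝ) + 2 * ε) = 2 * ε * m := by
    rw [Finset.sum_add_distrib, Finset.sum_sub_distrib, hx1]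
    simp only [Finset.sum_const, Finset.card_univ, Fintype.card_fin, nsmul_eq_mul]
    field_simp
    ring
  have hA : ∀ i, |x i - 1 / (m : ℝ)| ≤ 2 * ε * (m : ℝ) := by
    intro i
    have hi := Finset.single_le_sum (fun j _ => hz j) (Finset.mem_univ i)
    rw [hs] at hi
    have := hz i
    rw [abs_le]
    constructor <;> nlinarith
  refine ⟨hA, ?_⟩
  calc ∑ i, |x i - unif (Finset.univ : Finset (Fin m)) i|
      ≤ ∑ _i : Fin m, 2 * ε * (m : ℝ) := by
        refine Finset.sum_le_sum fun i _ => ?_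
        have := hA i
        simpa [unif] using this
    _ = 2 * ε * (m : ℝ) ^ 2 := by
        simp only [Finset.sum_const, Finset.card_univ, Fintype.card_fin, nsmul_eq_mul]
        ring
end
end

section
/- There exists an absolute constant C₀ > 0 such that the following holds. For every n ≥ 1, every nonempty S ⊆ [n] with associated high-precision game (R^S, C^S), every ε ≥ 0, every integer T ≥ 1, and every uniform T-sparse ε-CCE μ = (1/T) ∑_{t=1}^T x^{(t)} ⊗ y^{(t)} of (R^S, C^S), it holds that ‖(1/T) ∑_{t=1}^T x^{(t)} − u(S)‖₁ ≤ C₀·n²·ε. -/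
open Finset Matrix

noncomputable section

/-- Row player's payoff matrix of the high-precision game associated with a nonempty
`S ⊆ [n]` (`m = |S|`): `−1` if `i ∉ S`; `1/2` if `i ∈ S, j ∉ S`; and
`[i = j] + 1/2 − 1/m` if `i, j ∈ S`. -/
def HPR {n : ℕ} (S : Finset (Fin n)) : Matrix (Fin n) (Fin n) ℝ := fun i j =>
  if i ∈ S then
    (if j ∈ S then (if i = j then 1 else 0) + 1 / 2 - 1 / (S.card : ℝ) else 1 / 2)
  else -1

/-- Column player's payoff matrix of the high-precision game: `−1` if `j ∉ S`; `1/2` if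
`j ∈ S, i ∉ S`; and `−[i = j] + 1/2 + 1/m` if `i, j ∈ S`. -/
def HPC {n : ℕ} (S : Finset (Fin n)) : Matrix (Fin n) (Fin n) ℝ := fun i j =>
  if j ∈ S then
    (if i ∈ S then -(if i = j then 1 else 0) + 1 / 2 + 1 / (S.card : ℝ) else 1 / 2)
  else -1

theorem hp_unif_mem {n : ℕ} (S : Finset (Fin n)) (hS : S.Nonempty) : unif S ∈ simplex n := by
  have hm : (S.card : ℝ) ≠ 0 := by exact_mod_cast hS.card_pos.ne'
  refine ⟨fun i => ?_, ?_⟩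
  · unfold unif; split_ifs <;> positivity
  · simp [unif, hm]

theorem hp_L1 {n : ℕ} (S : Finset (Fin n)) (hS : S.Nonempty) (v : Fin n → ℝ)
    (hv : v ∈ simplex n) : unif S ⬝ᵥ (HPR S).mulVec v = 1 / 2 := by
  have hm : (S.card : ℝ) ≠ 0 := by exact_mod_cast hS.card_pos.ne'
  have hcol : ∀ j, (unif S ᵥ* HPR S) j = 1 / 2 := by
    intro j
    have : (unif S ᵥ* HPR S) j = ∑ i ∈ S, (S.card : ℝ)⁻¹ * HPR S i j := by
      simp [vecMul, dotProduct, unif, ite_mul]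
    rw [this, ← Finset.mul_sum]
    by_cases hj : j ∈ S
    · have : ∑ i ∈ S, HPR S i j = ∑ i ∈ S, ((if i = j then (1:ℝ) else 0) + (1 / 2 - 1 / (S.card : ℝ))) := by
        refine Finset.sum_congr rfl fun i hi => ?_
        simp only [HPR, hi, hj, if_true]; ring
      rw [this, Finset.sum_add_distrib, Finset.sum_ite_eq' S j, if_pos hj, Finset.sum_const, nsmul_eq_mul]
      field_simp
      ring
    · have : ∑ i ∈ S, HPR S i j = ∑ i ∈ S, (1 / 2 : ℝ) := by
        refine Finset.sum_congr rfl fun i hi => ?_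
        simp only [HPR, hi, hj, if_true, if_false]
      rw [this, Finset.sum_const, nsmul_eq_mul]
      field_simp
  rw [dotProduct_mulVec, dotProduct]
  simp only [hcol]
  rw [← Finset.mul_sum, hv.2, mul_one]

theorem hp_L2 {n : ℕ} (S : Finset (Fin n)) (u : Fin n → ℝ)
    (hu : u ∈ simplex n) (j : Fin n) (hj : j ∈ S) :
    u ⬝ᵥ (HPC S).mulVec (Pi.single j 1) = 1 / 2 - u j + (∑ i ∈ S, u i) / (S.card : ℝ) := by
  have h1 : u ⬝ᵥ (HPC S).mulVec (Pi.single j 1) = ∑ i, u i * HPC S i j := by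
    simp [dotProduct]
  have h2 : ∀ i, u i * HPC S i j = u i * (1 / 2) - (if i = j then u i else 0)
      + (if i ∈ S then u i else 0) / (S.card : ℝ) := by
    intro i
    by_cases hi : i ∈ S
    · by_cases hij : i = j
      · simp only [HPC, hi, hj, hij, if_true]; ring
      · simp only [HPC, hi, hj, hij, if_true, if_false]; ring
    · have hij : i ≠ j := fun h => hi (h ▸ hj)
      simp only [HPC, hi, hj, hij, if_true, if_false]; ring
  rw [h1, Finset.sum_congr rfl fun i _ => h2 i, Finset.sum_add_distrib, Finset.sum_sub_distrib,
    ← Finset.sum_mul, hu.2, ← Finset.sum_div]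
  simp

theorem hp_L3 {n : ℕ} (S : Finset (Fin n)) (u v : Fin n → ℝ)
    (hu : u ∈ simplex n) (hv : v ∈ simplex n) :
    u ⬝ᵥ (HPR S).mulVec v + u ⬝ᵥ (HPC S).mulVec v ≤ -1 / 2 + 3 / 2 * ∑ i ∈ S, u i := by
  rw [← dotProduct_add, ← add_mulVec]
  have hrow : ∀ i, ((HPR S + HPC S) *ᵥ v) i ≤ -1 / 2 + 3 / 2 * (if i ∈ S then 1 else 0) := by
    intro i
    have : ((HPR S + HPC S) *ᵥ v) i ≤ ∑ j, (-1 / 2 + 3 / 2 * (if i ∈ S then (1:ℝ) else 0)) * v j := by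
      change ∑ j, (HPR S + HPC S) i j * v j ≤ _
      refine Finset.sum_le_sum fun j _ => mul_le_mul_of_nonneg_right ?_ (hv.1 j)
      simp only [Matrix.add_apply, HPR, HPC]
      by_cases hi : i ∈ S <;> by_cases hj : j ∈ S <;> simp only [hi, hj, if_true, if_false] <;>
        ring_nf <;> norm_num
    rwa [← Finset.mul_sum, hv.2, mul_one] at this
  calc u ⬝ᵥ ((HPR S + HPC S) *ᵥ v)
      ≤ ∑ i, u i * (-1 / 2 + 3 / 2 * (if i ∈ S then 1 else 0)) :=
        Finset.sum_le_sum fun i _ => mul_le_mul_of_nonneg_left (hrow i) (hu.1 i)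
    _ = ∑ i, (u i * (-1 / 2) + 3 / 2 * (if i ∈ S then u i else 0)) := by
        refine Finset.sum_congr rfl fun i _ => ?_
        split_ifs <;> ring
    _ = -1 / 2 + 3 / 2 * ∑ i ∈ S, u i := by
        rw [Finset.sum_add_distrib, ← Finset.sum_mul, hu.2, ← Finset.mul_sum]
        simp

/-- there is a constant `C₀ > 0` such that in any high-precision game, the
average of Player x's marginals of any uniform `T`-sparse `ε`-CCE is within `C₀·n²·ε` of
the uniform distribution over `S` in `ℓ₁`. -/
theorem highPrecision_marginal_close_to_uniform :
    ∃ C₀ > (0 : ℝ),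
      ∀ (n : ℕ), 1 ≤ n → ∀ S : Finset (Fin n), S.Nonempty →
      ∀ ε : ℝ, 0 ≤ ε → ∀ T : ℕ, 1 ≤ T →
      ∀ x y : Fin T → Fin n → ℝ,
        (∀ t, x t ∈ simplex n) → (∀ t, y t ∈ simplex n) →
        IsSparseCCE (HPR S) (HPC S) T x y ε →
        ∑ i, |(1 / (T : ℝ)) * (∑ t, x t i) - unif S i| ≤ C₀ * (n : ℝ) ^ 2 * ε := by
  refine ⟨4, by norm_num, ?_⟩
  intro n hn S hS ε hε T hT x y hx hy hC
  have hT0 : (0:ℝ) < T := by exact_mod_cast hT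
  have hm1 : (1:ℝ) ≤ S.card := by exact_mod_cast hS.card_pos
  have hu := hp_unif_mem S hS
  set X : Fin n → ℝ := fun i => (1 / (T : ℝ)) * (∑ t, x t i) with hX
  set s : ℝ := (1 / (T : ℝ)) * ∑ t, ∑ i ∈ S, x t i with hs
  have avg : ∀ c : ℝ, (1 / (T : ℝ)) * ∑ _t : Fin T, c = c := by
    intro c; simp; field_simp
  have hX0 : ∀ i, 0 ≤ X i := fun i =>
    mul_nonneg (by positivity) (Finset.sum_nonneg fun t _ => (hx t).1 i)
  have hX1 : ∑ i, X i = 1 := by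
    simp only [hX]
    rw [← Finset.mul_sum, Finset.sum_comm, Finset.sum_congr rfl fun t _ => (hx t).2]
    exact avg 1
  have hs1 : s ≤ 1 := by
    rw [← avg 1]
    refine mul_le_mul_of_nonneg_left (Finset.sum_le_sum fun t _ => ?_) (by positivity)
    rw [← (hx t).2]
    exact Finset.sum_le_sum_of_subset_of_nonneg (Finset.subset_univ _) fun i _ _ => (hx t).1 i
  have h1 := hC.1 _ hu
  rw [Finset.sum_congr rfl fun t _ => hp_L1 S hS (y t) (hy t), avg] at h1
  have h3 : (1 / (T : ℝ)) * ∑ t, x t ⬝ᵥ (HPR S).mulVec (y t)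
      + (1 / (T : ℝ)) * ∑ t, x t ⬝ᵥ (HPC S).mulVec (y t) ≤ -1 / 2 + 3 / 2 * s := by
    have : (1 / (T : ℝ)) * ∑ t, (x t ⬝ᵥ (HPR S).mulVec (y t) + x t ⬝ᵥ (HPC S).mulVec (y t))
        ≤ (1 / (T : ℝ)) * ∑ t, (-1 / 2 + 3 / 2 * ∑ i ∈ S, x t i) :=
      mul_le_mul_of_nonneg_left
        (Finset.sum_le_sum fun t _ => hp_L3 S (x t) (y t) (hx t) (hy t)) (by positivity)
    rw [Finset.sum_add_distrib, Finset.sum_add_distrib, mul_add, mul_add, avg,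
      ← Finset.mul_sum] at this
    rw [hs]; linarith
  have hlow : ∀ i, unif S i - X i ≤ 2 * ε := by
    intro j
    by_cases hj : j ∈ S
    · have hsing : (Pi.single j 1 : Fin n → ℝ) ∈ simplex n := by
        refine ⟨fun i => ?_, by simp⟩
        by_cases h : i = j
        · subst h; simp
        · simp [h]
      have h2 := hC.2 _ hsing
      rw [Finset.sum_congr rfl fun t _ => hp_L2 S (x t) (hx t) j hj, Finset.sum_add_distrib,
        Finset.sum_sub_distrib, mul_add, mul_sub, avg, ← Finset.sum_div, ← mul_div_assoc,
        ← hs] at h2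
      have hXj : X j = (1 / (T : ℝ)) * ∑ t, x t j := rfl
      rw [← hXj] at h2
      have hun : unif S j = (S.card : ℝ)⁻¹ := by simp [unif, hj]
      have hinv : (S.card : ℝ)⁻¹ ≤ 1 := inv_le_one_of_one_le₀ hm1
      rw [div_eq_mul_inv s] at h2
      rw [hun]
      nlinarith [mul_nonneg (sub_nonneg.2 hs1) (sub_nonneg.2 hinv)]
    · have hun : unif S j = 0 := by simp [unif, hj]
      rw [hun]; linarith [hX0 j]
  have hsum : ∑ i, |X i - unif S i| ≤ ∑ i, (X i - unif S i + 4 * ε) := by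
    refine Finset.sum_le_sum fun i _ => ?_
    rw [abs_le]
    constructor <;> linarith [hlow i]
  rw [Finset.sum_add_distrib, Finset.sum_sub_distrib, hX1, hu.2] at hsum
  simp at hsum
  have hn1 : (1:ℝ) ≤ n := by exact_mod_cast hn
  refine hsum.trans ?_
  nlinarith [mul_nonneg (mul_nonneg (sub_nonneg.2 hn1) hε) (by linarith : (0:ℝ) ≤ n)]
end
end
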